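/- arXiv:math/0011205 — 5 statements merged into one kernel-verified Lean document; each statement's English description precedes it below -/
import Mathlib

section
/- Let X be a derivation on ℂ[x,y,z] and d ≥ 1 an integer. Suppose F, G ∈ ℂ[x,y,z] are ℂ-linearly independent homogeneous polynomials of the same degree d satisfying G·X(F) = F·X(G) (i.e., the rational function F/G is a first integral of X of degree d). Then the d-th extactic polynomial E_d(X) vanishes identically. -/
open MvPolynomial

/-- The `n`-th extactic polynomial of a derivation `D` on `ℂ[x,y,z]`, with respect to an
enumeration `mono` of the exponents of the `(n+1)(n+2)/2` monomials of degree `n`. -/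
noncomputable def extactic
    (D : Derivation ℂ (MvPolynomial (Fin 3) ℂ) (MvPolynomial (Fin 3) ℂ)) (n : ℕ)
    (mono : Fin ((n + 1) * (n + 2) / 2) → (Fin 3 →₀ ℕ)) : MvPolynomial (Fin 3) ℂ :=
  Matrix.det (Matrix.of fun i j : Fin ((n + 1) * (n + 2) / 2) =>
    (⇑D)^[(i : ℕ)] (monomial (mono j) (1 : ℂ)))

/-- The iterates of a derivation respect a first integral `F / G`. -/
theorem Derivation.mul_iterate_comm_of_first_integral {k A : Type*} [CommRing k] [CommRing A]
    [IsDomain A] [Algebra k A] (D : Derivation k A A) {F G : A} (hG : G ≠ 0)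
    (h : G * D F = F * D G) (i : ℕ) : G * (⇑D)^[i] F = F * (⇑D)^[i] G := by
  induction i with
  | zero => simp [mul_comm]
  | succ i ih =>
    have hD := congrArg D ih
    simp only [Derivation.leibniz, smul_eq_mul] at hD
    rw [Function.iterate_succ_apply', Function.iterate_succ_apply']
    have hcross : (⇑D)^[i] F * D G = (⇑D)^[i] G * D F :=
      mul_left_cancel₀ hG (by linear_combination D G * ih - (⇑D)^[i] G * h)
    linear_combination hD - hcross

theorem Derivation.iterate_eq_toLinearMap_pow {k A : Type*} [CommRing k] [CommRing A]
    [Algebra k A] (D : Derivation k A A) (i : ℕ) (a : A) :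
    (⇑D)^[i] a = ((D : A →ₗ[k] A) ^ i) a := by
  rw [Module.End.pow_apply]
  rfl

/-- An injective family of `(d + 1) * (d + 2) / 2` exponents of degree `d` in three variables
exhausts all such exponents. -/
theorem exists_eq_of_injective_of_degree {d : ℕ}
    {mono : Fin ((d + 1) * (d + 2) / 2) → (Fin 3 →₀ ℕ)} (hinj : Function.Injective mono)
    (hdeg : ∀ j, ((mono j).sum fun _ e => e) = d) {m : Fin 3 →₀ ℕ}
    (hm : (m.sum fun _ e => e) = d) : ∃ j, mono j = m := by
  have hsub : Finset.univ.image mono ⊆ Finset.finsuppAntidiag Finset.univ d := by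
    intro a ha
    obtain ⟨j, -, rfl⟩ := Finset.mem_image.mp ha
    exact Finset.mem_finsuppAntidiag'.mpr ⟨hdeg j, Finset.subset_univ _⟩
  have hcard : (Finset.finsuppAntidiag (Finset.univ : Finset (Fin 3)) d).card ≤
      (Finset.univ.image mono).card := by
    rw [Finset.card_finsuppAntidiag_nat_eq_choose, Finset.card_image_of_injective _ hinj,
      Finset.card_univ, Finset.card_univ, Fintype.card_fin, Fintype.card_fin,
      show 3 + d - 1 = d + 2 by omega, Nat.choose_symm_add, Nat.choose_two_right,
      Nat.add_sub_assoc (by norm_num), mul_comm]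
  have hmem : m ∈ Finset.univ.image mono := by
    rw [Finset.eq_of_subset_of_card_le hsub hcard]
    exact Finset.mem_finsuppAntidiag'.mpr ⟨hm, Finset.subset_univ _⟩
  obtain ⟨j, -, hj⟩ := Finset.mem_image.mp hmem
  exact ⟨j, hj⟩

theorem MvPolynomial.sum_coeff_smul_monomial_eq {σ ι R : Type*} [CommSemiring R] [Fintype ι]
    {mono : ι → (σ →₀ ℕ)} (hinj : Function.Injective mono) {P : MvPolynomial σ R}
    (hP : ∀ m ∈ P.support, ∃ j, mono j = m) :
    ∑ j, P.coeff (mono j) • monomial (mono j) (1 : R) = P := by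
  classical
  conv_rhs => rw [P.as_sum]
  have hsub : P.support ⊆ Finset.univ.image mono := fun m hm => by
    obtain ⟨j, rfl⟩ := hP m hm
    exact Finset.mem_image_of_mem _ (Finset.mem_univ j)
  rw [Finset.sum_subset hsub fun m _ hm => by simp [notMem_support_iff.mp hm],
    Finset.sum_image hinj.injOn]
  simp [smul_monomial]

/-- If the derivation `D` admits a rational first integral `F/G` of degree `d`
(with `F`, `G` linearly independent homogeneous of degree `d` and `G·D(F) = F·D(G)`),
then the `d`-th extactic polynomial of `D` vanishes identically. -/
theorem extactic_stmt_3
    (D : Derivation ℂ (MvPolynomial (Fin 3) ℂ) (MvPolynomial (Fin 3) ℂ))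
    (d : ℕ) (hd : 1 ≤ d)
    (mono : Fin ((d + 1) * (d + 2) / 2) → (Fin 3 →₀ ℕ))
    (hinj : Function.Injective mono)
    (hdeg : ∀ j, ((mono j).sum fun _ e => e) = d)
    (F G : MvPolynomial (Fin 3) ℂ)
    (hF : F.IsHomogeneous d) (hG : G.IsHomogeneous d)
    (hFG : LinearIndependent ℂ ![F, G])
    (hfi : G * D F = F * D G) :
    extactic D d mono = 0 := by
  have hG0 : G ≠ 0 := hFG.ne_zero 1
  have hexp : ∀ P : MvPolynomial (Fin 3) ℂ, P.IsHomogeneous d →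
      ∑ j, P.coeff (mono j) • monomial (mono j) (1 : ℂ) = P := fun P hP =>
    sum_coeff_smul_monomial_eq hinj fun m hm => exists_eq_of_injective_of_degree hinj hdeg <| by
      by_contra hne
      exact mem_support_iff.mp hm (hP.coeff_eq_zero hne)
  have hiter : ∀ P : MvPolynomial (Fin 3) ℂ, P.IsHomogeneous d → ∀ i : ℕ,
      ∑ j, (⇑D)^[i] (monomial (mono j) (1 : ℂ)) * C (P.coeff (mono j)) = (⇑D)^[i] P := by
    intro P hP i
    conv_rhs => rw [← hexp P hP]
    simp only [Derivation.iterate_eq_toLinearMap_pow, map_sum, map_smul]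
    simp only [smul_eq_C_mul, mul_comm]
  obtain ⟨j₀, hj₀⟩ : ∃ j, G.coeff (mono j) ≠ 0 := by
    by_contra! hzero
    exact hG0 (by rw [← hexp G hG]; simp [hzero])
  refine Matrix.exists_mulVec_eq_zero_iff.mp
    ⟨fun j => G * C (F.coeff (mono j)) - F * C (G.coeff (mono j)), fun hv => ?_, ?_⟩
  · have hj := congrFun hv j₀
    have hrel : (-G.coeff (mono j₀)) • F + F.coeff (mono j₀) • G = 0 := by
      simp only [smul_eq_C_mul, map_neg]
      simp only [Pi.zero_apply] at hj
      linear_combination hj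
    exact hj₀ (neg_eq_zero.mp (LinearIndependent.pair_iff.mp hFG _ _ hrel).1)
  · ext1 i
    simp only [Matrix.mulVec, dotProduct, Matrix.of_apply, Pi.zero_apply, mul_sub,
      Finset.sum_sub_distrib, mul_left_comm _ G, mul_left_comm _ F, ← Finset.mul_sum]
    rw [hiter F hF, hiter G hG, sub_eq_zero]
    exact D.mul_iterate_comm_of_first_integral hG0 hfi i
end

section
/- Let X = a·∂/∂x + b·∂/∂y + c·∂/∂z be a derivation on ℂ[x,y,z] with a, b, c homogeneous polynomials of the same degree m, and assume X is not a polynomial multiple of the Euler derivation, i.e., there is no polynomial h with (a,b,c) = (x·h, y·h, z·h). Then for every d ≥ 1: X admits a rational first integral of degree d and admits no rational first integral of degree smaller than d if and only if E_d(X) = 0 and E_{d−1}(X) ≠ 0 (where for d = 1 the second condition is vacuous). -/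
open MvPolynomial

/-- `D` admits a rational first integral of degree `e`: there are `ℂ`-linearly independent
homogeneous polynomials `F`, `G` of degree `e` with `G·D(F) = F·D(G)`. -/
def HasRatFirstIntegral
    (D : Derivation ℂ (MvPolynomial (Fin 3) ℂ) (MvPolynomial (Fin 3) ℂ)) (e : ℕ) : Prop :=
  ∃ F G : MvPolynomial (Fin 3) ℂ, F.IsHomogeneous e ∧ G.IsHomogeneous e ∧
    LinearIndependent ℂ ![F, G] ∧ G * D F = F * D G

theorem Derivation.exists_extension_of_formallyEtale {R S T : Type*} [CommRing R] [CommRing S]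
    [CommRing T] [Algebra R S] [Algebra S T] [Algebra R T] [IsScalarTower R S T]
    [Algebra.FormallyEtale S T] (D : Derivation R S S) :
    ∃ E : Derivation R T T, ∀ s, E (algebraMap S T s) = algebraMap S T (D s) := by
  let e := KaehlerDifferential.tensorKaehlerEquivOfFormallyEtale R S T
  let l : TensorProduct S T (KaehlerDifferential R S) →ₗ[T] T :=
    ((Algebra.linearMap S T).comp D.liftKaehlerDifferential).liftBaseChange T
  refine ⟨(l.comp e.symm.toLinearMap).compDer (KaehlerDifferential.D R T), fun s => ?_⟩
  simp [e, l, KaehlerDifferential.tensorKaehlerEquivOfFormallyEtale_symm_D_algebraMap]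

namespace MvPolynomial

variable {σ R : Type*} [CommRing R]

theorem homogeneousComponent_mul_of_isHomogeneous {f : MvPolynomial σ R} {r : ℕ}
    (hf : f.IsHomogeneous r) (g : MvPolynomial σ R) (k : ℕ) :
    homogeneousComponent (r + k) (f * g) = f * homogeneousComponent k g := by
  let _ : GradedAlgebra (homogeneousSubmodule σ R) := gradedAlgebra
  have h := DirectSum.coe_decompose_mul_add_of_left_mem (homogeneousSubmodule σ R) (i := r)
    (j := k) (a := f) (b := g) hf
  exact ((decomposition.decompose'_apply _ _).symm.trans h).trans
    (congrArg (f * ·) (decomposition.decompose'_apply _ _))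

theorem isHomogeneous_iff_homogeneousComponent {f : MvPolynomial σ R} {r : ℕ} :
    f.IsHomogeneous r ↔ ∀ k, k ≠ r → homogeneousComponent k f = 0 := by
  classical
  refine ⟨fun h k hk => ?_, fun h => ?_⟩
  · rw [homogeneousComponent_of_mem h, if_neg hk]
  · intro s hs
    by_contra hne
    apply hs
    have := congrArg (coeff s) (h s.degree (by rwa [Finsupp.degree_eq_weight_one]))
    simpa [coeff_homogeneousComponent] using this

theorem IsHomogeneous.of_mul_left [IsDomain R] {f g : MvPolynomial σ R} {r : ℕ}
    (h : (f * g).IsHomogeneous r) (h0 : f * g ≠ 0) : ∃ k, f.IsHomogeneous k := by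
  classical
  let φ : MvPolynomial σ R →ₐ[R] Polynomial (MvPolynomial σ R) :=
    MvPolynomial.aeval fun i : σ => Polynomial.C (X i) * Polynomial.X
  have hmon : ∀ (s : σ →₀ ℕ) (a : R),
      φ (monomial s a) = Polynomial.monomial s.degree (monomial s a) := by
    intro s a
    rw [aeval_monomial, monomial_eq (s := s)]
    simp only [mul_pow, Finsupp.prod, Finset.prod_mul_distrib, Finset.prod_pow_eq_pow_sum,
      ← Polynomial.C_mul_X_pow_eq_monomial, Finsupp.degree, map_mul, map_prod, map_pow]
    rw [mul_assoc]
    rfl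
  have hcoeff : ∀ (p : MvPolynomial σ R) (k : ℕ), (φ p).coeff k = homogeneousComponent k p := by
    intro p k
    induction p using MvPolynomial.induction_on' with
    | monomial s a =>
      rw [hmon, Polynomial.coeff_monomial]
      rw [homogeneousComponent_of_mem (isHomogeneous_monomial a rfl)]
      simp [eq_comm]
    | add p q hp hq => simp [hp, hq]
  have hφ : φ f * φ g = Polynomial.monomial r (f * g) := by
    rw [← map_mul]
    ext1 k
    rw [hcoeff, homogeneousComponent_of_mem h, Polynomial.coeff_monomial]
    simp [eq_comm]
  have hne : φ f * φ g ≠ 0 := by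
    rw [hφ]; simpa using h0
  have hf := left_ne_zero_of_mul hne
  have hg := right_ne_zero_of_mul hne
  have h1 := Polynomial.natDegree_mul hf hg
  have h2 := Polynomial.natTrailingDegree_mul hf hg
  rw [hφ, Polynomial.natDegree_monomial_eq _ h0] at h1
  rw [hφ, Polynomial.natTrailingDegree_monomial h0] at h2
  have h3 := Polynomial.natTrailingDegree_le_natDegree (φ f)
  have h4 := Polynomial.natTrailingDegree_le_natDegree (φ g)
  refine ⟨(φ f).natDegree, isHomogeneous_iff_homogeneousComponent.2 fun k hk => ?_⟩
  rw [← hcoeff]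
  rcases lt_or_gt_of_ne hk with h | h
  · exact Polynomial.coeff_eq_zero_of_lt_natTrailingDegree (by omega)
  · exact Polynomial.coeff_eq_zero_of_natDegree_lt h

theorem isHomogeneous_derivation [Fintype σ]
    (D : Derivation R (MvPolynomial σ R) (MvPolynomial σ R))
    {m : ℕ} (hD : ∀ i, (D (X i)).IsHomogeneous m) {f : MvPolynomial σ R} {k : ℕ}
    (hf : f.IsHomogeneous k) : (D f).IsHomogeneous (k - 1 + m) := by
  classical
  have : D = ∑ i, D (X i) • pderiv (R := R) i := by
    apply derivation_ext
    intro j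
    rw [← Derivation.coeFnAddMonoidHom_apply (∑ i, _), map_sum, Finset.sum_apply]
    simp [pderiv_X, Pi.single_apply]
  rw [this, ← Derivation.coeFnAddMonoidHom_apply, map_sum, Finset.sum_apply]
  refine IsHomogeneous.sum _ _ _ fun i _ => ?_
  rw [add_comm]
  exact (hD i).mul hf.pderiv

/-- A Gauss lemma: constants can be cancelled from a multiple of a primitive polynomial. -/
theorem dvd_of_C_mul_eq_mul [IsDomain R] [UniqueFactorizationMonoid R] {S P : MvPolynomial σ R}
    (hP : ∀ q : R, Prime q → ¬ C q ∣ P) {a : R} (ha : a ≠ 0) :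
    ∀ T, C a * S = P * T → P ∣ S := by
  induction a using UniqueFactorizationMonoid.induction_on_prime with
  | h₁ => exact absurd rfl ha
  | h₂ a hu =>
    intro T hT
    exact (IsUnit.dvd_mul_left (hu.map C)).1 ⟨T, hT⟩
  | h₃ a q h0 hq ih =>
    intro T hT
    have hdvd : C q ∣ P * T := ⟨C a * S, by rw [← hT, map_mul, mul_assoc]⟩
    rcases ((prime_C_iff σ).2 hq).dvd_or_dvd hdvd with h | ⟨T', rfl⟩
    · exact absurd h (hP q hq)
    · refine ih h0 T' (mul_left_cancel₀ (C_ne_zero.2 hq.ne_zero) ?_)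
      rw [← mul_assoc, ← map_mul, hT]
      ring

end MvPolynomial

/-- A linear relation among the columns of the matrix of the first `N` iterates of a derivation on
`N` elements can be chosen to persist for all iterates. -/
theorem exists_forall_sum_mul_iterate_eq_zero {R A : Type*} [CommRing R] [CommRing A] [IsDomain A]
    [Algebra R A] (D : Derivation R A A) {N : ℕ} (g : Fin N → A)
    (hdet : (Matrix.of fun i j : Fin N => D^[(i : ℕ)] (g j)).det = 0) :
    ∃ v : Fin N → A, v ≠ 0 ∧ ∀ i : ℕ, ∑ j, v j * D^[i] (g j) = 0 := by
  classical
  obtain ⟨v, hv0, hv⟩ := Matrix.exists_mulVec_eq_zero_iff.2 hdet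
  obtain ⟨w, hw0, hw⟩ := Matrix.exists_vecMul_eq_zero_iff.2 hdet
  refine ⟨v, hv0, ?_⟩
  let row : ℕ → Fin N → A := fun i j => D^[i] (g j)
  let W : ℕ → Submodule A (Fin N → A) := fun n => Submodule.span A (row '' Set.Iio n)
  have hrow : ∀ {l n : ℕ}, l < n → row l ∈ W n := fun h => Submodule.subset_span ⟨_, h, rfl⟩
  have hmono : ∀ {l n : ℕ}, l ≤ n → W l ≤ W n := fun h =>
    Submodule.span_mono (Set.image_mono (Set.Iio_subset_Iio h))
  have hD : ∀ (n : ℕ) (u : Fin N → A), u ∈ W n → (fun j => D (u j)) ∈ W (n + 1) := by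
    intro n u hu
    induction hu using Submodule.span_induction with
    | mem x hx =>
      obtain ⟨l, hl, rfl⟩ := hx
      have : (fun j => D (row l j)) = row (l + 1) := by
        funext j
        simp only [row, Function.iterate_succ_apply']
      rw [this]
      exact hrow (Nat.succ_lt_succ hl)
    | zero => simp only [Pi.zero_apply, map_zero]; exact zero_mem _
    | add x y _ _ hx hy =>
      simp only [Pi.add_apply, map_add]
      exact add_mem hx hy
    | smul a x hx' hx =>
      have : (fun j => D ((a • x) j)) = a • (fun j => D (x j)) + D a • x := by
        funext j
        simp [mul_comm]
      rw [this]
      exact add_mem (Submodule.smul_mem _ _ hx) (Submodule.smul_mem _ _ (hmono n.le_succ hx'))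
  obtain ⟨r, hr0, hr⟩ : ∃ r : Fin N, w r ≠ 0 ∧ ∀ l, r < l → w l = 0 := by
    have hne : (Finset.univ.filter fun i => w i ≠ 0).Nonempty := by
      obtain ⟨i, hi⟩ := Function.ne_iff.1 hw0
      exact ⟨i, by simpa using hi⟩
    refine ⟨_, (Finset.mem_filter.1 (Finset.max'_mem _ hne)).2, fun l hl => ?_⟩
    by_contra h
    exact absurd (Finset.le_max' _ l (by simpa using h)) (not_le.2 hl)
  have hbase : w r • row r ∈ W r := by
    have h : ∑ i, w i • row i = 0 := by
      funext j
      simpa [Matrix.vecMul, dotProduct, row] using congrFun hw j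
    rw [← Finset.add_sum_erase _ _ (Finset.mem_univ r)] at h
    rw [eq_neg_of_add_eq_zero_left h]
    refine neg_mem (Submodule.sum_mem _ fun i hi => ?_)
    rcases lt_or_gt_of_ne (Finset.ne_of_mem_erase hi) with h | h
    · exact Submodule.smul_mem _ _ (hrow h)
    · simp [hr i h]
  have hstep : ∀ k : ℕ, w r • row (r + k) ∈ W (r + k) := by
    intro k
    induction k with
    | zero => exact hbase
    | succ k ih =>
      have h := hD _ _ ih
      have : (fun j => D ((w r • row (r + k)) j)) =
          w r • row (r + (k + 1)) + D (w r) • row (r + k) := by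
        funext j
        simp only [row, ← add_assoc, Function.iterate_succ_apply', Pi.smul_apply, Pi.add_apply,
          smul_eq_mul, Derivation.leibniz]
        ring
      rw [this] at h
      exact (Submodule.add_mem_iff_left _ (Submodule.smul_mem _ _ (hrow (by omega)))).1 h
  intro i
  induction i using Nat.strong_induction_on with
  | _ i ih =>
    by_cases hi : i < N
    · have := congrFun hv ⟨i, hi⟩
      simpa [Matrix.mulVec, dotProduct, mul_comm] using this
    · have h := hstep (i - r)
      rw [show (r : ℕ) + (i - r) = i by omega] at h
      have hker : ∀ u ∈ W i, ∑ j, v j * u j = 0 := by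
        intro u hu
        induction hu using Submodule.span_induction with
        | mem x hx =>
          obtain ⟨l, hl, rfl⟩ := hx
          exact ih l hl
        | zero => simp
        | add x y _ _ hx hy => simp [mul_add, Finset.sum_add_distrib, hx, hy]
        | smul a x _ hx =>
          simp_rw [Pi.smul_apply, smul_eq_mul, mul_left_comm _ a, ← Finset.mul_sum, hx, mul_zero]
      have h' := hker _ h
      simp_rw [Pi.smul_apply, smul_eq_mul, mul_left_comm _ (w r), ← Finset.mul_sum] at h'
      exact (mul_eq_zero.1 h').resolve_left hr0

/-- A relation minimal in support can be chosen homogeneous, with ratios of coefficients constant. -/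
theorem exists_isHomogeneous_relation {σ R : Type*} [Fintype σ] [CommRing R] [IsDomain R]
    (D : Derivation R (MvPolynomial σ R) (MvPolynomial σ R)) {m : ℕ}
    (hD : ∀ i, (D (X i)).IsHomogeneous m) {ι : Type*} [Fintype ι] {n : ℕ}
    (g : ι → MvPolynomial σ R) (hg : ∀ j, (g j).IsHomogeneous n)
    (h : ∃ v : ι → MvPolynomial σ R, v ≠ 0 ∧ ∀ i : ℕ, ∑ j, v j * D^[i] (g j) = 0) :
    ∃ (v : ι → MvPolynomial σ R) (r : ℕ), v ≠ 0 ∧ (∀ j, (v j).IsHomogeneous r) ∧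
      ∑ j, v j * g j = 0 ∧ ∀ j k, v j * D (v k) = v k * D (v j) := by
  classical
  have hiter : ∀ i : ℕ, ∃ e, ∀ j, (D^[i] (g j)).IsHomogeneous e := by
    intro i
    induction i with
    | zero => exact ⟨n, hg⟩
    | succ i ih =>
      obtain ⟨e, he⟩ := ih
      exact ⟨e - 1 + m, fun j => by
        rw [Function.iterate_succ_apply']; exact isHomogeneous_derivation D hD (he j)⟩
  let S : Set (ι → MvPolynomial σ R) := {v | v ≠ 0 ∧ ∀ i : ℕ, ∑ j, v j * D^[i] (g j) = 0}
  let c : (ι → MvPolynomial σ R) → ℕ := fun v => (Finset.univ.filter fun j => v j ≠ 0).card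
  let v := Function.argminOn c S h
  have hvS : v ∈ S := Function.argminOn_mem c S h
  have hmin : ∀ u ∈ S, c v ≤ c u := fun u hu => Function.argminOn_le c S hu
  obtain ⟨j₀, hj₀⟩ := Function.ne_iff.1 hvS.1
  obtain ⟨r, hr⟩ : ∃ r, homogeneousComponent r (v j₀) ≠ 0 := by
    by_contra! hcon
    apply hj₀
    rw [← sum_homogeneousComponent (v j₀)]
    exact Finset.sum_eq_zero fun i _ => hcon i
  let u : ι → MvPolynomial σ R := fun j => homogeneousComponent r (v j)
  have hu0 : u ≠ 0 := fun h => hr (congrFun h j₀)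
  have hurel : ∀ i : ℕ, ∑ j, u j * D^[i] (g j) = 0 := by
    intro i
    obtain ⟨e, he⟩ := hiter i
    have := congrArg (homogeneousComponent (e + r)) (hvS.2 i)
    rw [map_sum, map_zero] at this
    rw [← this]
    refine Finset.sum_congr rfl fun j _ => ?_
    rw [mul_comm (v j), homogeneousComponent_mul_of_isHomogeneous (he j), mul_comm]
  have hle : c u ≤ c v := Finset.card_le_card fun j hj => by
    simp only [Finset.mem_filter, Finset.mem_univ, true_and, u] at hj ⊢
    intro h0
    exact hj (by rw [h0, map_zero])
  refine ⟨u, r, hu0, fun j => homogeneousComponent_isHomogeneous _ _, hurel 0, fun j k => ?_⟩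
  by_cases hk : u k = 0
  · simp [hk]
  let w : ι → MvPolynomial σ R := fun j => u k * D (u j) - u j * D (u k)
  suffices hw : w = 0 by
    have := congrFun hw j
    simp only [w, Pi.zero_apply] at this
    exact (sub_eq_zero.1 this).symm
  by_contra hw0
  have hwS : w ∈ S := by
    refine ⟨hw0, fun i => ?_⟩
    have h1 := congrArg D (hurel i)
    simp only [map_sum, Derivation.leibniz, smul_eq_mul, map_zero, Finset.sum_add_distrib,
      ← Function.iterate_succ_apply' (⇑D), hurel (i + 1), zero_add] at h1
    have h2 : ∑ j, w j * D^[i] (g j) =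
        u k * ∑ j, D^[i] (g j) * D (u j) - D (u k) * ∑ j, u j * D^[i] (g j) := by
      rw [Finset.mul_sum, Finset.mul_sum, ← Finset.sum_sub_distrib]
      refine Finset.sum_congr rfl fun j _ => ?_
      simp only [w]
      ring
    rw [h2, h1, hurel i]
    simp
  have hlt : c w < c u := by
    refine Finset.card_lt_card ⟨fun j hj => ?_, fun hsub => ?_⟩
    · simp only [Finset.mem_filter, Finset.mem_univ, true_and, w] at hj ⊢
      intro h0
      exact hj (by simp [h0])
    · have := @hsub k (by simpa using hk)
      simp [w] at this
  have := hmin w hwS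
  omega

/-- The relations satisfied by an algebraically dependent pair of elements form a principal ideal,
unless both are algebraic. -/
theorem exists_dvd_iff_aeval_eq_zero {F L : Type*} [Field F] [Field L] [Algebra F L]
    (u : Fin 2 → L) (h : ∃ q : MvPolynomial (Fin 2) F, q ≠ 0 ∧ aeval u q = 0) :
    (∀ i, IsAlgebraic F (u i)) ∨
      ∃ p : MvPolynomial (Fin 2) F, p ≠ 0 ∧ ∀ q, aeval u q = 0 ↔ p ∣ q := by
  let I : Ideal (MvPolynomial (Fin 2) F) := RingHom.ker (aeval (R := F) u)
  have hI : I.IsPrime := RingHom.ker_isPrime _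
  have hbot : I ≠ ⊥ := by
    obtain ⟨q, hq0, hq⟩ := h
    exact fun h0 => hq0 (by simpa [h0] using (show q ∈ I from hq))
  by_cases hmax : I.IsMaximal
  · left
    intro i
    let _ := Ideal.Quotient.field I
    have : Module.Finite F (MvPolynomial (Fin 2) F ⧸ I) :=
      finite_of_finite_type_of_isJacobsonRing _ _
    have hint : IsIntegral F (Ideal.Quotient.mkₐ F I (X i)) := Algebra.IsIntegral.isIntegral _
    obtain ⟨f, hf, hfi⟩ := hint
    refine ⟨f, hf.ne_zero, ?_⟩
    rw [← Polynomial.aeval_def, Polynomial.aeval_algHom_apply] at hfi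
    have h2 : Polynomial.aeval (X i) f ∈ I := Ideal.Quotient.eq_zero_iff_mem.1 hfi
    have h3 : aeval u (Polynomial.aeval (X i : MvPolynomial (Fin 2) F) f) = 0 := h2
    rwa [← Polynomial.aeval_algHom_apply, aeval_X] at h3
  · right
    have hh : I.height = 1 := by
      apply le_antisymm
      · obtain ⟨M, hM, hIM⟩ := Ideal.exists_le_maximal I hI.ne_top
        have hlt : I < M := lt_of_le_of_ne hIM fun h => hmax (h ▸ hM)
        have h1 : I.height + 1 ≤ M.height := Ideal.height_add_one_le_of_lt_of_isPrime hlt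
        have h2 : (M.height : WithBot ℕ∞) ≤ 2 := by
          have := Ideal.height_le_ringKrullDim_of_ne_top hM.ne_top
          simpa using this
        have h3 : M.height ≤ 2 := WithBot.coe_le_coe.1 h2
        have h4 : I.height + 1 ≤ 1 + 1 := by simpa [one_add_one_eq_two] using h1.trans h3
        exact (ENat.add_le_add_iff_right (by simp)).1 h4
      · rwa [Order.one_le_iff_ne_zero, Ne, Ideal.height_eq_zero_iff_eq_bot]
    obtain ⟨p, hp⟩ := (UniqueFactorizationMonoid.isPrincipal_of_height_eq_one hh).principal
    refine ⟨p, fun h0 => hbot (by rw [hp, h0]; simp), fun q => ?_⟩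
    rw [← Ideal.mem_span_singleton, Ideal.span, ← hp]
    rfl

theorem Derivation.eq_zero_of_isAlgebraic {k L : Type*} [Field k] [Field L] [Algebra k L]
    [CharZero k] (E : Derivation k L L) (K : IntermediateField k L) (hK : ∀ f ∈ K, E f = 0) {u : L}
    (hu : IsAlgebraic K u) : E u = 0 := by
  let E' : Derivation K L L := Derivation.mk'
    { toFun := E
      map_add' := map_add E
      map_smul' := fun a f => by
        simp [Algebra.smul_def, hK a a.2] }
    fun a b => by simp
  have hchar : CharZero K := charZero_of_injective_algebraMap (algebraMap k K).injective
  have hsep := (minpoly.irreducible hu.isIntegral).separable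
  have h := E'.map_aeval (minpoly K u) u
  rw [minpoly.aeval, map_zero] at h
  exact (smul_eq_zero.1 h.symm).resolve_left
    (hsep.aeval_derivative_ne_zero (minpoly.aeval K u))

namespace MvPolynomial

theorem aeval_algebraMap_X {σ R L : Type*} [CommRing R] [CommRing L] [Algebra R L]
    [Algebra (MvPolynomial σ R) L] [IsScalarTower R (MvPolynomial σ R) L] (F : MvPolynomial σ R) :
    aeval (fun i => algebraMap (MvPolynomial σ R) L (X i)) F = algebraMap _ L F :=
  (aeval_algebraMap_apply L X F).trans (congrArg _ (aeval_X_left_apply F))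

/-- Setting the variable of index `0` equal to `1`. -/
noncomputable def dehomogenize (R : Type*) [CommRing R] (N : ℕ) :
    MvPolynomial (Fin (N + 1)) R →ₐ[R] MvPolynomial (Fin N) R :=
  aeval (Fin.cons 1 X)

theorem dehomogenize_monomial {R : Type*} [CommRing R] {N : ℕ} (t : Fin (N + 1) →₀ ℕ) (a : R) :
    dehomogenize R N (monomial t a) = monomial t.tail a := by
  rw [dehomogenize, aeval_monomial, monomial_eq, algebraMap_eq,
    Finsupp.prod_fintype _ _ (by simp), Finsupp.prod_fintype _ _ (by simp), Fin.prod_univ_succ]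
  simp [Finsupp.tail_apply]

theorem degree_eq_add_degree_tail {N : ℕ} (t : Fin (N + 1) →₀ ℕ) :
    t.degree = t 0 + t.tail.degree := by
  simp [Finsupp.degree_eq_sum, Fin.sum_univ_succ, Finsupp.tail_apply]

theorem IsHomogeneous.aeval_dehomogenize_mul_pow {R L : Type*} [CommRing R] [Field L] [Algebra R L]
    {N r : ℕ} {F : MvPolynomial (Fin (N + 1)) R} (hF : F.IsHomogeneous r) (w : Fin (N + 1) → L)
    (hw : w 0 ≠ 0) :
    MvPolynomial.aeval (fun i => w (Fin.succ i) / w 0) (dehomogenize R N F) * w 0 ^ r =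
      MvPolynomial.aeval w F := by
  rw [F.as_sum, map_sum, map_sum, map_sum, Finset.sum_mul]
  refine Finset.sum_congr rfl fun t ht => ?_
  have hdeg : t.degree = r := by
    by_contra h
    exact mem_support_iff.1 ht (hF.coeff_eq_zero h)
  rw [dehomogenize_monomial, aeval_monomial, aeval_monomial, Finsupp.prod_fintype _ _ (by simp),
    Finsupp.prod_fintype _ _ (by simp), Fin.prod_univ_succ, ← hdeg, degree_eq_add_degree_tail,
    pow_add, Finsupp.degree_eq_sum, ← Finset.prod_pow_eq_pow_sum]
  simp only [div_pow, Finset.prod_div_distrib, Finsupp.tail_apply]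
  have : ∏ i : Fin N, w 0 ^ t i.succ ≠ 0 := Finset.prod_ne_zero_iff.2 fun i _ => pow_ne_zero _ hw
  field_simp

theorem IsHomogeneous.eq_zero_of_dehomogenize_eq_zero {R : Type*} [CommRing R] [IsDomain R]
    {N r : ℕ} {F : MvPolynomial (Fin (N + 1)) R} (hF : F.IsHomogeneous r)
    (h : dehomogenize R N F = 0) : F = 0 := by
  let L := FractionRing (MvPolynomial (Fin (N + 1)) R)
  let w : Fin (N + 1) → L := fun i => algebraMap (MvPolynomial (Fin (N + 1)) R) L (X i)
  have hw : w 0 ≠ 0 := by simp [w]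
  have h1 := hF.aeval_dehomogenize_mul_pow w hw
  have h2 : MvPolynomial.aeval w F = algebraMap _ L F := by
    exact aeval_algebraMap_X F
  rw [h, map_zero, zero_mul, h2] at h1
  exact (map_eq_zero_iff _ (IsFractionRing.injective _ L)).1 h1.symm

theorem exists_isHomogeneous_dehomogenize_eq {R : Type*} [CommRing R] {N n : ℕ}
    (f : MvPolynomial (Fin N) R) (hf : f.totalDegree ≤ n) :
    ∃ F : MvPolynomial (Fin (N + 1)) R, F.IsHomogeneous n ∧ dehomogenize R N F = f := by
  refine ⟨∑ s ∈ f.support, monomial (Finsupp.cons (n - s.degree) s) (coeff s f),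
    IsHomogeneous.sum _ _ _ fun s hs => isHomogeneous_monomial _ ?_, ?_⟩
  · have : s.degree ≤ n := (le_totalDegree hs).trans hf
    rw [degree_eq_add_degree_tail, Finsupp.cons_zero, Finsupp.tail_cons]
    omega
  · simp only [map_sum, dehomogenize_monomial, Finsupp.tail_cons]
    exact f.as_sum.symm

theorem exists_coeff_eq {σ R S : Type*} [CommRing R] [CommRing S] (φ : R → S) (h0 : φ 0 = 0)
    (p : MvPolynomial σ R) :
    ∃ q : MvPolynomial σ S, q.support ⊆ p.support ∧ ∀ s, coeff s q = φ (coeff s p) := by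
  classical
  have h : ∀ s, coeff s (∑ t ∈ p.support, monomial t (φ (coeff t p))) = φ (coeff s p) := by
    intro s
    by_cases hs : coeff s p = 0 <;> simp [coeff_sum, coeff_monomial, hs, h0]
  refine ⟨_, fun s hs => ?_, h⟩
  rw [mem_support_iff, h] at hs
  rw [mem_support_iff]
  exact fun h => hs (by rw [h, h0])

theorem exists_C_mul_eq_map {σ A L : Type*} [CommRing A] [IsDomain A] [Field L] [Algebra A L]
    [IsFractionRing A L] (f : MvPolynomial σ L) :
    ∃ (a : A) (T : MvPolynomial σ A), a ≠ 0 ∧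
      C (algebraMap A L a) * f = map (algebraMap A L) T := by
  obtain ⟨b, hb⟩ := IsLocalization.exist_integer_multiples (nonZeroDivisors A) f.support
    (fun s => coeff s f)
  refine ⟨b, ?_⟩
  have h : ∀ s, ∃ c : A, algebraMap A L c = algebraMap A L b * coeff s f := by
    intro s
    by_cases hs : s ∈ f.support
    · obtain ⟨c, hc⟩ := hb s hs
      exact ⟨c, by rw [hc, Algebra.smul_def]⟩
    · exact ⟨0, by simp [notMem_support_iff.1 hs]⟩
  choose c hc using h
  refine ⟨∑ s ∈ f.support, monomial s (c s), nonZeroDivisors.coe_ne_zero b, ?_⟩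
  conv_lhs => rw [f.as_sum]
  simp only [map_sum, map_monomial, hc, Finset.mul_sum, C_mul_monomial]

/-- A factor of a polynomial with coefficients homogeneous of a given degree, whose cofactor has
coefficients homogeneous of the same degree, has constant coefficients. -/
theorem exists_eq_map_C_of_mul_isHomogeneous {σ τ R : Type*} [CommRing R] [IsDomain R]
    {P T : MvPolynomial τ (MvPolynomial σ R)} {r : ℕ} (hP0 : P ≠ 0)
    (hP : ∀ s, (coeff s P).IsHomogeneous r) (hS : ∀ s, (coeff s (P * T)).IsHomogeneous r) :
    ∃ T₀ : MvPolynomial τ R, T = map C T₀ := by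
  classical
  have h : ∀ s k, k ≠ 0 → homogeneousComponent k (coeff s T) = 0 := by
    intro s k hk
    obtain ⟨Q, -, hQ⟩ := exists_coeff_eq (homogeneousComponent k) (map_zero _) T
    have hPQ : P * Q = 0 := by
      ext1 t
      rw [coeff_mul, coeff_zero,
        ← isHomogeneous_iff_homogeneousComponent.1 (hS t) (r + k) (by omega), coeff_mul, map_sum]
      refine Finset.sum_congr rfl fun x _ => ?_
      rw [hQ, homogeneousComponent_mul_of_isHomogeneous (hP _)]
    rw [← hQ, (mul_eq_zero.1 hPQ).resolve_left hP0, coeff_zero]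
  obtain ⟨T₀, -, hT₀⟩ := exists_coeff_eq (coeff 0 : MvPolynomial σ R → R) (coeff_zero _) T
  refine ⟨T₀, ?_⟩
  ext1 s
  rw [coeff_map, hT₀]
  have : (coeff s T).IsHomogeneous 0 := isHomogeneous_iff_homogeneousComponent.2 (h s)
  exact totalDegree_eq_zero_iff_eq_C.1 ((totalDegree_zero_iff_isHomogeneous _).2 this)

end MvPolynomial

theorem LinearIndependent.exists_linearMap_pair {k V : Type*} [Field k] [AddCommGroup V]
    [Module k V]
    {x y : V} (h : LinearIndependent k ![x, y]) (a b : k) :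
    ∃ l : V →ₗ[k] k, l x = a ∧ l y = b := by
  obtain ⟨l, hl⟩ := ((Finsupp.linearCombination k ![a, b]).comp h.repr).exists_extend
  have key : ∀ i, l (![x, y] i) = ![a, b] i := by
    intro i
    have h1 := LinearMap.congr_fun hl ⟨_, Submodule.subset_span (Set.mem_range_self i)⟩
    have h2 := h.repr_eq_single i ⟨_, Submodule.subset_span (Set.mem_range_self i)⟩ rfl
    simpa [h2] using h1
  exact ⟨l, key 0, key 1⟩

section

variable {σ k L : Type*} [Field k] [Field L] [Algebra k L] [Algebra (MvPolynomial σ k) L]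
  [IsScalarTower k (MvPolynomial σ k) L]

/-- The constants of a derivation of the field of rational functions that are quotients of
homogeneous polynomials of the same degree. -/
def homogeneousConstants (σ : Type*) [Algebra (MvPolynomial σ k) L]
    [IsScalarTower k (MvPolynomial σ k) L] [FaithfulSMul (MvPolynomial σ k) L]
    (E : Derivation k L L) : IntermediateField k L where
  carrier := {f | E f = 0 ∧ ∃ (r : ℕ) (a b : MvPolynomial σ k), a.IsHomogeneous r ∧
    b.IsHomogeneous r ∧ b ≠ 0 ∧ f * algebraMap _ L b = algebraMap _ L a}
  mul_mem' := by
    rintro f g ⟨hf, r, a, b, ha, hb, hb0, hab⟩ ⟨hg, s, c, d, hc, hd, hd0, hcd⟩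
    refine ⟨by simp [hf, hg], r + s, a * c, b * d, ha.mul hc, hb.mul hd, mul_ne_zero hb0 hd0, ?_⟩
    rw [map_mul, map_mul, ← hab, ← hcd]
    ring
  add_mem' := by
    rintro f g ⟨hf, r, a, b, ha, hb, hb0, hab⟩ ⟨hg, s, c, d, hc, hd, hd0, hcd⟩
    refine ⟨by simp [hf, hg], r + s, a * d + b * c, b * d, (ha.mul hd).add (hb.mul hc),
      hb.mul hd, mul_ne_zero hb0 hd0, ?_⟩
    rw [map_add, map_mul, map_mul, map_mul, ← hab, ← hcd]
    ring
  algebraMap_mem' c := by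
    refine ⟨by simp, 0, C c, 1, isHomogeneous_C _ _, isHomogeneous_one _ _, one_ne_zero, ?_⟩
    rw [map_one, mul_one, IsScalarTower.algebraMap_apply k (MvPolynomial σ k) L, algebraMap_eq]
  inv_mem' := by
    rintro f ⟨hf, r, a, b, ha, hb, hb0, hab⟩
    have hE : E f⁻¹ = 0 := by simp [Derivation.leibniz_inv, hf]
    by_cases ha0 : a = 0
    · have hbL : algebraMap (MvPolynomial σ k) L b ≠ 0 := by simpa using hb0
      have hf0 : f = 0 := by
        rw [ha0, map_zero] at hab
        exact (mul_eq_zero.1 hab).resolve_right hbL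
      exact ⟨hE, r, a, b, ha, hb, hb0, by rw [hf0, inv_zero, ← hf0, hab]⟩
    · have hf0 : f ≠ 0 := by
        rintro rfl
        rw [zero_mul] at hab
        exact ha0 (by simpa using hab.symm)
      exact ⟨hE, r, b, a, hb, ha, ha0, by rw [← hab, inv_mul_cancel_left₀ hf0]⟩

end

theorem exists_primitive_homogeneous_multiple {σ τ k L : Type*} [Field k] [Field L] [Algebra k L]
    [Algebra (MvPolynomial σ k) L] [IsScalarTower k (MvPolynomial σ k) L]
    [FaithfulSMul (MvPolynomial σ k) L] (E : Derivation k L L)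
    (p : MvPolynomial τ (homogeneousConstants σ E)) (hp : p ≠ 0) :
    ∃ (r : ℕ) (P : MvPolynomial τ (MvPolynomial σ k)) (c : L), c ≠ 0 ∧
      (∀ s, (coeff s P).IsHomogeneous r) ∧
      map (algebraMap (MvPolynomial σ k) L) P =
        C c * map (algebraMap (homogeneousConstants σ E) L) p ∧
      ∀ q : MvPolynomial σ k, Prime q → ¬ C q ∣ P := by
  classical
  let Q : ℕ → Prop := fun r => ∃ (P : MvPolynomial τ (MvPolynomial σ k)) (c : L), c ≠ 0 ∧
      (∀ s, (coeff s P).IsHomogeneous r) ∧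
      map (algebraMap (MvPolynomial σ k) L) P =
        C c * map (algebraMap (homogeneousConstants σ E) L) p
  have hQ : ∃ r, Q r := by
    have h : ∀ s, ∃ (r : ℕ) (a b : MvPolynomial σ k), a.IsHomogeneous r ∧
        b.IsHomogeneous r ∧ b ≠ 0 ∧
        ((coeff s p : homogeneousConstants σ E) : L) * algebraMap _ L b = algebraMap _ L a :=
      fun s => (coeff s p).2.2
    choose e a b ha hb hb0 hab using h
    refine ⟨∑ s ∈ p.support, e s,
      ∑ s ∈ p.support, monomial s (a s * ∏ t ∈ p.support.erase s, b t),
      algebraMap _ L (∏ t ∈ p.support, b t), ?_, fun s => ?_, ?_⟩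
    · simpa [Finset.prod_eq_zero_iff] using fun s _ => hb0 s
    · simp only [coeff_sum, coeff_monomial, Finset.sum_ite_eq']
      split_ifs with hs
      · rw [← Finset.add_sum_erase _ _ hs]
        exact (ha s).mul (IsHomogeneous.prod _ _ _ fun t _ => hb t)
      · exact isHomogeneous_zero _ _ _
    · conv_rhs => arg 2; rw [p.as_sum]
      simp only [map_sum, map_monomial, Finset.mul_sum, C_mul_monomial]
      refine Finset.sum_congr rfl fun s hs => ?_
      congr 1
      rw [← Finset.mul_prod_erase _ _ hs, map_mul, map_mul, ← hab]
      change _ = _ * ((coeff s p : homogeneousConstants σ E) : L)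
      ring
  obtain ⟨P, c, hc, hP, hPp⟩ := Nat.find_spec hQ
  refine ⟨Nat.find hQ, P, c, hc, hP, hPp, ?_⟩
  rintro q hq ⟨P', rfl⟩
  have hP0 : C q * P' ≠ 0 := by
    intro h0
    rw [h0, map_zero] at hPp
    have := mul_eq_zero.1 hPp.symm
    rw [C_eq_zero, or_iff_right hc, map_eq_zero_iff _
      (map_injective _ (algebraMap (homogeneousConstants σ E) L).injective)] at this
    exact hp this
  simp only [coeff_C_mul] at hP
  obtain ⟨s, hs⟩ := ne_zero_iff.1 (right_ne_zero_of_mul hP0)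
  have hqs := mul_ne_zero hq.ne_zero hs
  obtain ⟨l, hl⟩ := (hP s).of_mul_left hqs
  have hl0 : l ≠ 0 := by
    rintro rfl
    have hC := totalDegree_eq_zero_iff_eq_C.1 ((totalDegree_zero_iff_isHomogeneous _).2 hl)
    apply hq.not_isUnit
    rw [hC]
    refine (isUnit_iff_ne_zero.2 fun h0 => ?_).map C
    rw [h0, C_0] at hC
    exact hq.ne_zero hC
  have hle : l ≤ Nat.find hQ := by
    rw [← hl.totalDegree hq.ne_zero, ← (hP s).totalDegree hqs,
      totalDegree_mul_of_isDomain hq.ne_zero hs]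
    exact Nat.le_add_right _ _
  have hqL : algebraMap (MvPolynomial σ k) L q ≠ 0 := by simpa using hq.ne_zero
  refine Nat.find_min hQ (m := Nat.find hQ - l) (by omega)
    ⟨P', (algebraMap _ L q)⁻¹ * c, mul_ne_zero (inv_ne_zero hqL) hc, fun t => ?_, ?_⟩
  · refine isHomogeneous_iff_homogeneousComponent.2 fun j hj => ?_
    have h := isHomogeneous_iff_homogeneousComponent.1 (hP t) (l + j) (by omega)
    rw [homogeneousComponent_mul_of_isHomogeneous hl] at h
    exact (mul_eq_zero.1 h).resolve_left hq.ne_zero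
  · rw [C_mul, mul_assoc, ← hPp, map_mul, map_C, ← mul_assoc, ← C_mul, inv_mul_cancel₀ hqL, C_1,
      one_mul]

namespace MvPolynomial

theorem exists_coeff_mul_eq {τ k A : Type*} [CommRing k] [CommRing A] [Algebra k A]
    (l : A →ₗ[k] k) (P : MvPolynomial τ A) :
    ∃ f : MvPolynomial τ k, f.totalDegree ≤ P.totalDegree ∧
      ∀ T s, coeff s (f * T) = l (coeff s (P * map (algebraMap k A) T)) := by
  classical
  obtain ⟨f, hf, hfl⟩ := exists_coeff_eq l (map_zero _) P
  refine ⟨f, Finset.sup_mono hf, fun T s => ?_⟩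
  rw [coeff_mul, coeff_mul, map_sum]
  refine Finset.sum_congr rfl fun x _ => ?_
  rw [coeff_map, hfl, mul_comm (coeff x.1 P), ← Algebra.smul_def, map_smul, smul_eq_mul, mul_comm]

/-- If `G F(w) - F G(w)` has a factor of degree at most `n` in `w` whose cofactor does not
involve the coefficient variables, then `F / G` is a quotient of polynomials of degree `n`. -/
theorem exists_isHomogeneous_mul_eq_mul {k : Type*} [Field k] {N n r : ℕ}
    {F G : MvPolynomial (Fin (N + 1)) k} (hF : F.IsHomogeneous r) (hG : G.IsHomogeneous r)
    (hFG : LinearIndependent k ![F, G])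
    {P : MvPolynomial (Fin N) (MvPolynomial (Fin (N + 1)) k)} {T : MvPolynomial (Fin N) k}
    (hP : P.totalDegree ≤ n)
    (hPT : P * map C T = C G * map C (dehomogenize k N F) - C F * map C (dehomogenize k N G)) :
    ∃ F' G' : MvPolynomial (Fin (N + 1)) k, F'.IsHomogeneous n ∧ G'.IsHomogeneous n ∧
      LinearIndependent k ![F', G'] ∧ F * G' = F' * G := by
  have key : ∀ a b : k, ∃ F' : MvPolynomial (Fin (N + 1)) k, F'.IsHomogeneous n ∧
      dehomogenize k N F' * T = C a * dehomogenize k N F - C b * dehomogenize k N G := by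
    intro a b
    obtain ⟨l, hlF, hlG⟩ := hFG.exists_linearMap_pair b a
    obtain ⟨f, hf, hfl⟩ := exists_coeff_mul_eq l P
    obtain ⟨F', hF', rfl⟩ := exists_isHomogeneous_dehomogenize_eq f (hf.trans hP)
    refine ⟨F', hF', ?_⟩
    ext1 s
    rw [hfl, algebraMap_eq, hPT]
    simp only [coeff_sub, coeff_C_mul, coeff_map]
    rw [mul_comm G, mul_comm F, C_mul', C_mul', map_sub, map_smul, map_smul, hlF, hlG]
    simp [mul_comm]
  obtain ⟨F', hF', hF'T⟩ := key 1 0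
  obtain ⟨G', hG', hG'T⟩ := key 0 (-1)
  simp only [C_1, C_0, C_neg, one_mul, zero_mul, sub_zero, zero_sub, neg_mul, neg_neg]
    at hF'T hG'T
  refine ⟨F', G', hF', hG', ?_, ?_⟩
  · rw [LinearIndependent.pair_iff] at hFG ⊢
    intro a b hab
    have h : (a • F + b • G).IsHomogeneous r := (homogeneousSubmodule _ k r).add_mem
      (Submodule.smul_mem _ a hF) (Submodule.smul_mem _ b hG)
    refine hFG a b (h.eq_zero_of_dehomogenize_eq_zero ?_)
    rw [map_add, map_smul, map_smul, ← hF'T, ← hG'T, ← smul_mul_assoc, ← smul_mul_assoc, ← add_mul,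
      ← map_smul, ← map_smul, ← map_add, hab, map_zero, zero_mul]
  · have h : (F * G' - G * F').IsHomogeneous (r + n) := (hF.mul hG').sub (hG.mul hF')
    rw [mul_comm F', ← sub_eq_zero]
    refine h.eq_zero_of_dehomogenize_eq_zero ?_
    rw [map_sub, map_mul, map_mul, ← hF'T, ← hG'T]
    ring

end MvPolynomial
theorem Derivation.mul_apply_eq_of_mul_eq {R A : Type*} [CommRing R] [CommRing A] [IsDomain A]
    [Algebra R A] (D : Derivation R A A) {F G F' G' : A} (hG : G ≠ 0) (h : G * D F = F * D G)
    (h' : F * G' = F' * G) : G' * D F' = F' * D G' := by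
  have hD := congrArg D h'
  simp only [Derivation.leibniz, smul_eq_mul] at hD
  refine mul_left_cancel₀ (pow_ne_zero 2 hG) ?_
  linear_combination (-G * G') * hD + (G * D G' + G' * D G) * h' + G' ^ 2 * h

namespace MvPolynomial

theorem eq_zero_of_aeval_div_eq_zero {R L : Type*} [CommRing R] [IsDomain R] [Field L]
    [Algebra R L] {N : ℕ} [Algebra (MvPolynomial (Fin (N + 1)) R) L]
    [IsScalarTower R (MvPolynomial (Fin (N + 1)) R) L]
    [FaithfulSMul (MvPolynomial (Fin (N + 1)) R) L] {q : MvPolynomial (Fin N) R}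
    (hq : aeval (fun i : Fin N => algebraMap (MvPolynomial (Fin (N + 1)) R) L (X i.succ) /
      algebraMap (MvPolynomial (Fin (N + 1)) R) L (X 0)) q = 0) : q = 0 := by
  obtain ⟨Q, hQ, rfl⟩ := exists_isHomogeneous_dehomogenize_eq q le_rfl
  have h := hQ.aeval_dehomogenize_mul_pow
    (fun i => algebraMap (MvPolynomial (Fin (N + 1)) R) L (X i)) (by simp)
  rw [hq, zero_mul, aeval_algebraMap_X] at h
  rw [(map_eq_zero_iff _ (FaithfulSMul.algebraMap_injective _ L)).1 h.symm, map_zero]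

end MvPolynomial

section

variable {k L : Type*} [Field k] [Field L] [Algebra k L] {N : ℕ}
  [Algebra (MvPolynomial (Fin (N + 1)) k) L] [IsScalarTower k (MvPolynomial (Fin (N + 1)) k) L]

theorem exists_linearIndependent_coeff [FaithfulSMul (MvPolynomial (Fin (N + 1)) k) L]
    {K : IntermediateField k L} {p : MvPolynomial (Fin N) K} (hp0 : p ≠ 0)
    (hp : aeval (fun i : Fin N => algebraMap (MvPolynomial (Fin (N + 1)) k) L (X i.succ) /
      algebraMap (MvPolynomial (Fin (N + 1)) k) L (X 0)) p = 0)
    {P : MvPolynomial (Fin N) (MvPolynomial (Fin (N + 1)) k)} {c : L} (hc : c ≠ 0)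
    (hP : ∀ s, algebraMap _ L (coeff s P) = c * algebraMap K L (coeff s p)) :
    ∃ s t, LinearIndependent k ![coeff s P, coeff t P] := by
  by_contra! h
  obtain ⟨s, hs⟩ := ne_zero_iff.1 hp0
  have hPs : coeff s P ≠ 0 := by
    intro h0
    have := hP s
    rw [h0, map_zero] at this
    simp [hc, hs] at this
  have hdep : ∀ t, ∃ a : k, a • coeff s P = coeff t P := by
    intro t
    have := h s t
    rw [LinearIndependent.pair_iff' hPs] at this
    push Not at this
    exact this
  choose a ha using hdep
  have hcoeff : ∀ t, coeff t p = coeff s p * algebraMap k K (a t) := by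
    intro t
    apply (algebraMap K L).injective
    refine mul_left_cancel₀ hc ?_
    rw [← hP, ← ha, Algebra.smul_def, map_mul, map_mul, hP, algebraMap_eq, ← algebraMap_eq,
      ← IsScalarTower.algebraMap_apply, ← IsScalarTower.algebraMap_apply]
    ring
  have hp' : p = C (coeff s p) *
      map (algebraMap k K) (∑ t ∈ p.support, monomial t (a t)) := by
    simp only [map_sum, map_monomial, Finset.mul_sum, C_mul_monomial, ← hcoeff]
    exact p.as_sum
  rw [hp', map_mul, aeval_C, aeval_map_algebraMap] at hp
  have hq := eq_zero_of_aeval_div_eq_zero ((mul_eq_zero.1 hp).resolve_left (by simpa using hs))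
  rw [hq, map_zero, mul_zero] at hp'
  exact hp0 hp'

/-- If the ideal of relations of the affine coordinates over the field of homogeneous constants is
generated by a polynomial of degree at most `n`, there is a rational first integral of degree `n`. -/
theorem exists_firstIntegral_of_dvd_iff [IsFractionRing (MvPolynomial (Fin (N + 1)) k) L]
    (D : Derivation k (MvPolynomial (Fin (N + 1)) k) (MvPolynomial (Fin (N + 1)) k))
    (E : Derivation k L L)
    (hE : ∀ F, E (algebraMap (MvPolynomial (Fin (N + 1)) k) L F) = algebraMap _ L (D F))
    {n : ℕ} {p : MvPolynomial (Fin N) (homogeneousConstants (Fin (N + 1)) E)} (hp0 : p ≠ 0)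
    (hn : p.totalDegree ≤ n)
    (hp : ∀ q, aeval (fun i : Fin N => algebraMap (MvPolynomial (Fin (N + 1)) k) L (X i.succ) /
      algebraMap (MvPolynomial (Fin (N + 1)) k) L (X 0)) q = 0 ↔ p ∣ q) :
    ∃ F G : MvPolynomial (Fin (N + 1)) k, F.IsHomogeneous n ∧ G.IsHomogeneous n ∧
      LinearIndependent k ![F, G] ∧ G * D F = F * D G := by
  let A := MvPolynomial (Fin (N + 1)) k
  let K := homogeneousConstants (Fin (N + 1)) E
  have hinj : Function.Injective (algebraMap A L) := IsFractionRing.injective A L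
  obtain ⟨r, P, c, hc, hP, hPp, hprim⟩ := exists_primitive_homogeneous_multiple E p hp0
  have hcoeff : ∀ s, algebraMap A L (coeff s P) = c * algebraMap K L (coeff s p) := by
    intro s
    have := congrArg (coeff s) hPp
    rwa [coeff_map, coeff_C_mul, coeff_map] at this
  have hP0 : P ≠ 0 := by
    rintro rfl
    exact hprim (X 0) X_prime (dvd_zero _)
  have hPn : P.totalDegree ≤ n := by
    refine le_trans (Finset.sup_mono fun s hs => ?_) hn
    rw [mem_support_iff] at hs ⊢
    intro h0
    have := hcoeff s
    rw [h0, map_zero, mul_zero] at this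
    exact hs (by simpa using this)
  obtain ⟨s, t, hst⟩ := exists_linearIndependent_coeff hp0 ((hp p).2 dvd_rfl) hc hcoeff
  set F := coeff s P with hFdef
  set G := coeff t P with hGdef
  have hG0 : G ≠ 0 := hst.ne_zero 1
  have hptL : algebraMap K L (coeff t p) ≠ 0 := by
    intro h0
    have := hcoeff t
    rw [h0, mul_zero] at this
    exact hG0 (by simpa using this)
  let κ : K := coeff s p / coeff t p
  have hκ : algebraMap K L κ * algebraMap A L G = algebraMap A L F := by
    rw [hFdef, hGdef, hcoeff, hcoeff, map_div₀]
    field_simp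
  have hD : G * D F = F * D G := by
    apply hinj
    have h := congrArg E hκ
    have hκ0 : E (algebraMap K L κ) = 0 := κ.2.1
    rw [Derivation.leibniz, hκ0, smul_zero, add_zero, smul_eq_mul, hE, hE] at h
    rw [map_mul, map_mul, ← h, ← hκ]
    ring
  let S : MvPolynomial (Fin N) A :=
    C G * map C (dehomogenize k N F) - C F * map C (dehomogenize k N G)
  let S' : MvPolynomial (Fin N) K :=
    map (algebraMap k K) (dehomogenize k N F) - C κ * map (algebraMap k K) (dehomogenize k N G)
  have hS' : p ∣ S' := by
    rw [← hp, map_sub, map_mul, aeval_C, aeval_map_algebraMap, aeval_map_algebraMap]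
    have hX : algebraMap A L (X 0) ≠ 0 := (map_ne_zero_iff _ hinj).2 (X_ne_zero 0)
    have h1 := (hP s).aeval_dehomogenize_mul_pow (fun i => algebraMap A L (X i)) hX
    have h2 := (hP t).aeval_dehomogenize_mul_pow (fun i => algebraMap A L (X i)) hX
    rw [aeval_algebraMap_X] at h1 h2
    refine (mul_eq_zero.1 ?_).resolve_right (pow_ne_zero r hX)
    rw [sub_mul, mul_assoc, h1, h2, hκ, sub_self]
  obtain ⟨q, hq⟩ := hS'
  have hmap : ∀ f : MvPolynomial (Fin N) k,
      map (algebraMap K L) (map (algebraMap k K) f) = map (algebraMap A L) (map C f) := by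
    intro f
    rw [map_map, map_map, ← IsScalarTower.algebraMap_eq, ← algebraMap_eq,
      ← IsScalarTower.algebraMap_eq]
  have hSL : map (algebraMap A L) S =
      map (algebraMap A L) P * (C (algebraMap A L G / c) * map (algebraMap K L) q) := by
    have h1 : map (algebraMap A L) S = C (algebraMap A L G) * map (algebraMap K L) S' := by
      simp only [S, S', map_sub, map_mul, map_C, hmap, ← hκ]
      ring
    rw [h1, hq, map_mul, hPp]
    have h2 : (C (algebraMap A L G) : MvPolynomial (Fin N) L) = C (algebraMap A L G / c) * C c := by
      rw [← C_mul, div_mul_cancel₀ _ hc]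
    rw [h2]
    ring
  obtain ⟨a, T, ha, hT⟩ :=
    exists_C_mul_eq_map (A := A) (C (algebraMap A L G / c) * map (algebraMap K L) q)
  have hST : C a * S = P * T := by
    apply map_injective _ hinj
    rw [map_mul, map_mul, map_C, hSL, ← hT]
    ring
  obtain ⟨T, hT⟩ := dvd_of_C_mul_eq_mul hprim ha T hST
  obtain ⟨T, rfl⟩ := exists_eq_map_C_of_mul_isHomogeneous hP0 hP (T := T) fun u => by
    rw [← hT, coeff_sub, coeff_C_mul, coeff_C_mul, coeff_map, coeff_map]
    have h1 := (hP t).mul (isHomogeneous_C (Fin (N + 1)) (coeff u (dehomogenize k N F)))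
    have h2 := (hP s).mul (isHomogeneous_C (Fin (N + 1)) (coeff u (dehomogenize k N G)))
    exact h1.sub h2
  obtain ⟨F', G', hF', hG', hFG', h⟩ :=
    exists_isHomogeneous_mul_eq_mul (hP s) (hP t) hst hPn hT.symm
  exact ⟨F', G', hF', hG', hFG', D.mul_apply_eq_of_mul_eq hG0 hD h⟩

end

section

variable {D : Derivation ℂ (MvPolynomial (Fin 3) ℂ) (MvPolynomial (Fin 3) ℂ)} {m n : ℕ}

theorem HasRatFirstIntegral.mono {e : ℕ} (h : HasRatFirstIntegral D e) (hen : e ≤ n) :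
    HasRatFirstIntegral D n := by
  obtain ⟨F, G, hF, hG, hFG, h⟩ := h
  have hX : (X 0 : MvPolynomial (Fin 3) ℂ) ^ (n - e) ≠ 0 := pow_ne_zero _ (X_ne_zero 0)
  have hXh := isHomogeneous_X_pow (R := ℂ) (0 : Fin 3) (n - e)
  obtain ⟨l, rfl⟩ := Nat.exists_eq_add_of_le hen
  rw [Nat.add_sub_cancel_left] at hX hXh
  refine ⟨F * X 0 ^ l, G * X 0 ^ l, hF.mul hXh, hG.mul hXh, ?_,
    D.mul_apply_eq_of_mul_eq (G := G) (hFG.ne_zero 1) h (by ring)⟩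
  rw [LinearIndependent.pair_iff] at hFG ⊢
  refine fun a b hab => hFG a b ((mul_eq_zero.1 ?_).resolve_right hX)
  rw [add_mul, smul_mul_assoc, smul_mul_assoc, hab]

theorem hasRatFirstIntegral_of_extactic_eq_zero
    (hD : ∀ i : Fin 3, (D (X i)).IsHomogeneous m) (hn : 1 ≤ n)
    {mono : Fin ((n + 1) * (n + 2) / 2) → (Fin 3 →₀ ℕ)} (hinj : Function.Injective mono)
    (hdeg : ∀ j, (mono j).degree = n) (h : extactic D n mono = 0) :
    HasRatFirstIntegral D n := by
  classical
  let A := MvPolynomial (Fin 3) ℂ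
  let L := FractionRing A
  have hinjL : Function.Injective (algebraMap A L) := IsFractionRing.injective A L
  have : Algebra.FormallyEtale A L := Algebra.FormallyEtale.of_isLocalization (nonZeroDivisors A)
  obtain ⟨E, hE⟩ := D.exists_extension_of_formallyEtale (T := L)
  let K := homogeneousConstants (Fin 3) E
  let u : Fin 2 → L := fun i => algebraMap A L (X i.succ) / algebraMap A L (X 0)
  have hX : algebraMap A L (X 0) ≠ 0 := (map_ne_zero_iff _ hinjL).2 (X_ne_zero 0)
  obtain ⟨v, r, hv0, hv, hrel, hvD⟩ := exists_isHomogeneous_relation D hD _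
    (fun j => isHomogeneous_monomial (1 : ℂ) (hdeg j))
    (exists_forall_sum_mul_iterate_eq_zero D _ h)
  obtain ⟨j₀, hj₀⟩ := Function.ne_iff.1 hv0
  have hvL : algebraMap A L (v j₀) ≠ 0 := (map_ne_zero_iff _ hinjL).2 hj₀
  have hκ : ∀ j, ∃ κ : K, algebraMap K L κ * algebraMap A L (v j₀) = algebraMap A L (v j) := by
    intro j
    have h1 : algebraMap A L (v j) / algebraMap A L (v j₀) * algebraMap A L (v j₀) =
      algebraMap A L (v j) := div_mul_cancel₀ _ hvL
    refine ⟨⟨algebraMap A L (v j) / algebraMap A L (v j₀), ?_, r, v j, v j₀, hv j, hv j₀, hj₀, h1⟩,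
      h1⟩
    have h2 := congrArg (algebraMap A L) (hvD j j₀)
    rw [map_mul, map_mul] at h2
    rw [Derivation.leibniz_div, hE, hE, smul_eq_mul, smul_eq_mul, smul_eq_mul, ← h2, sub_self,
      mul_zero]
  choose κ hκ using hκ
  have htail : Function.Injective fun j => (mono j).tail := by
    intro i j hij
    apply hinj
    have h0 : mono i 0 = mono j 0 := by
      have hi := hdeg i
      have hj := hdeg j
      rw [degree_eq_add_degree_tail] at hi hj
      have : (mono i).tail.degree = (mono j).tail.degree := congrArg _ hij
      omega
    rw [← Finsupp.cons_tail (mono i), ← Finsupp.cons_tail (mono j), h0]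
    exact congrArg _ hij
  let q : MvPolynomial (Fin 2) K := ∑ j, monomial (mono j).tail (κ j)
  have hq0 : q ≠ 0 := by
    refine ne_zero_iff.2 ⟨(mono j₀).tail, ?_⟩
    have hκ0 : κ j₀ ≠ 0 := by
      intro h0
      have := hκ j₀
      rw [h0, map_zero, zero_mul] at this
      exact hvL this.symm
    rw [coeff_sum, Finset.sum_eq_single j₀]
    · simpa using hκ0
    · intro j _ hj
      rw [coeff_monomial, if_neg (fun h => hj (htail h))]
    · simp
  have hqn : q.totalDegree ≤ n := by
    refine totalDegree_finsetSum_le fun j _ => (totalDegree_monomial_le _ _).trans ?_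
    rw [← hdeg j, degree_eq_add_degree_tail (mono j)]
    exact Nat.le_add_left _ _
  have hqu : aeval u q = 0 := by
    refine (mul_eq_zero.1 ?_).resolve_right (mul_ne_zero (pow_ne_zero n hX) hvL)
    rw [← mul_assoc, map_sum, Finset.sum_mul, Finset.sum_mul, ← map_zero (algebraMap A L), ← hrel,
      map_sum]
    refine Finset.sum_congr rfl fun j _ => ?_
    have h1 := (isHomogeneous_monomial (1 : ℂ) (hdeg j)).aeval_dehomogenize_mul_pow
      (fun i => algebraMap A L (X i)) hX
    rw [aeval_algebraMap_X, dehomogenize_monomial, aeval_monomial, map_one, one_mul] at h1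
    rw [map_mul, ← hκ j, aeval_monomial, ← h1]
    ring
  rcases exists_dvd_iff_aeval_eq_zero u ⟨q, hq0, hqu⟩ with halg | ⟨p, hp0, hp⟩
  · have hu : E (u 0) = 0 := E.eq_zero_of_isAlgebraic K (fun f hf => hf.1) (halg 0)
    refine HasRatFirstIntegral.mono ⟨X 1, X 0, isHomogeneous_X _ _, isHomogeneous_X _ _, ?_, ?_⟩ hn
    · rw [LinearIndependent.pair_iff]
      intro a b hab
      have h0 := congrArg (coeff (Finsupp.single 0 1)) hab
      have h1 := congrArg (coeff (Finsupp.single 1 1)) hab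
      simp [coeff_X, Finsupp.single_left_inj] at h0 h1
      exact ⟨h1, h0⟩
    · apply hinjL
      rw [Derivation.leibniz_div, smul_eq_zero, or_iff_right (pow_ne_zero 2 (inv_ne_zero hX)), hE,
        hE, sub_eq_zero] at hu
      rw [map_mul, map_mul]
      exact hu
  · exact exists_firstIntegral_of_dvd_iff D E hE hp0
      ((totalDegree_le_of_dvd_of_isDomain ((hp q).1 hqu) hq0).trans hqn) hp

/-- An injective enumeration by `(n + 1) * (n + 2) / 2` indices of exponents of degree `n` in three
variables attains all of them. -/
theorem exists_eq_of_injective_of_degree_eq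
    {mono : Fin ((n + 1) * (n + 2) / 2) → (Fin 3 →₀ ℕ)} (hinj : Function.Injective mono)
    (hdeg : ∀ j, (mono j).degree = n) {s : Fin 3 →₀ ℕ} (hs : s.degree = n) : ∃ j, mono j = s := by
  classical
  have hcard : (Finset.finsuppAntidiag (Finset.univ : Finset (Fin 3)) n).card =
      (n + 1) * (n + 2) / 2 := by
    rw [Finset.card_finsuppAntidiag_nat_eq_choose, Finset.card_fin, show 3 + n - 1 = n + 2 by omega,
      Nat.choose_symm_add, Nat.choose_two_right, mul_comm]
    rfl
  have himg : Finset.univ.image mono = Finset.finsuppAntidiag (Finset.univ : Finset (Fin 3)) n := by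
    refine Finset.eq_of_subset_of_card_le (fun t ht => ?_) ?_
    · obtain ⟨j, -, rfl⟩ := Finset.mem_image.1 ht
      rw [Finset.mem_finsuppAntidiag, ← Finsupp.degree_eq_sum]
      exact ⟨hdeg j, Finset.subset_univ _⟩
    · rw [hcard, Finset.card_image_of_injective _ hinj, Finset.card_fin]
  have hmem : s ∈ Finset.univ.image mono := by
    rw [himg, Finset.mem_finsuppAntidiag, ← Finsupp.degree_eq_sum]
    exact ⟨hs, Finset.subset_univ _⟩
  simpa using hmem

theorem HasRatFirstIntegral.extactic_eq_zero (h : HasRatFirstIntegral D n)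
    {mono : Fin ((n + 1) * (n + 2) / 2) → (Fin 3 →₀ ℕ)} (hinj : Function.Injective mono)
    (hdeg : ∀ j, (mono j).degree = n) : extactic D n mono = 0 := by
  classical
  obtain ⟨F, G, hF, hG, hFG, h⟩ := h
  have hG0 : G ≠ 0 := hFG.ne_zero 1
  have hsum : ∀ {H : MvPolynomial (Fin 3) ℂ}, H.IsHomogeneous n → ∀ i : ℕ,
      ∑ j, D^[i] (monomial (mono j) 1) * C (coeff (mono j) H) = D^[i] H := by
    intro H hH i
    induction i with
    | zero =>
      ext1 s
      simp only [Function.iterate_zero_apply, mul_comm _ (C _), C_mul_monomial, mul_one, coeff_sum,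
        coeff_monomial]
      by_cases hs : s.degree = n
      · obtain ⟨j, rfl⟩ := exists_eq_of_injective_of_degree_eq hinj hdeg hs
        simp [hinj.eq_iff]
      · rw [hH.coeff_eq_zero hs]
        exact Finset.sum_eq_zero fun j _ => if_neg fun h : mono j = s => hs (h ▸ hdeg j)
    | succ i ih =>
      rw [Function.iterate_succ_apply', ← ih, map_sum]
      simp only [Function.iterate_succ_apply', Derivation.leibniz, ← algebraMap_eq,
        Derivation.map_algebraMap, mul_zero, zero_add, smul_eq_mul]
      exact Finset.sum_congr rfl fun j _ => mul_comm _ _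
  have hiter : ∀ i : ℕ, G * D^[i] F = F * D^[i] G := by
    intro i
    induction i with
    | zero => exact mul_comm _ _
    | succ i ih =>
      rw [Function.iterate_succ_apply', Function.iterate_succ_apply']
      have h1 := congrArg D ih
      simp only [Derivation.leibniz, smul_eq_mul] at h1
      refine mul_left_cancel₀ hG0 ?_
      linear_combination G * h1 + D^[i] G * h - D G * ih
  refine Matrix.exists_mulVec_eq_zero_iff.1
    ⟨fun j => C (coeff (mono j) F) * G - C (coeff (mono j) G) * F, fun h0 => ?_, ?_⟩
  · obtain ⟨j, hj⟩ : ∃ j, coeff (mono j) F ≠ 0 := by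
      by_contra! hcon
      apply hFG.ne_zero 0
      have := hsum hF 0
      simpa [hcon] using this.symm
    have h1 : C (coeff (mono j) F) * G - C (coeff (mono j) G) * F = 0 := congrFun h0 j
    rw [LinearIndependent.pair_iff] at hFG
    refine hj (hFG (-coeff (mono j) G) (coeff (mono j) F) ?_).2
    rw [← C_mul', ← C_mul', C_neg]
    linear_combination h1
  · funext i
    simp only [Matrix.mulVec, dotProduct, Matrix.of_apply, mul_sub, ← mul_assoc,
      Finset.sum_sub_distrib, ← Finset.sum_mul, Pi.zero_apply]
    rw [hsum hF, hsum hG, sub_eq_zero, mul_comm, hiter, mul_comm]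

end

/-- For a derivation `D = a·∂x + b·∂y + c·∂z` with `a,b,c` homogeneous of the same
degree `m`, not a polynomial multiple of the Euler derivation: `D` admits a rational first
integral of degree `d` and none of smaller degree iff `E_d(D) = 0` and `E_{d-1}(D) ≠ 0`
(the latter condition being vacuous for `d = 1`). -/
theorem extactic_stmt_4
    (D : Derivation ℂ (MvPolynomial (Fin 3) ℂ) (MvPolynomial (Fin 3) ℂ))
    (m : ℕ)
    (hhom : ∀ i : Fin 3, (D (X i)).IsHomogeneous m)
    (hEuler : ¬ ∃ h : MvPolynomial (Fin 3) ℂ, ∀ i : Fin 3, D (X i) = X i * h)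
    (d : ℕ) (hd : 1 ≤ d)
    (mono : Fin ((d + 1) * (d + 2) / 2) → (Fin 3 →₀ ℕ))
    (hinj : Function.Injective mono)
    (hdeg : ∀ j, ((mono j).sum fun _ e => e) = d)
    (mono' : Fin ((d - 1 + 1) * (d - 1 + 2) / 2) → (Fin 3 →₀ ℕ))
    (hinj' : Function.Injective mono')
    (hdeg' : ∀ j, ((mono' j).sum fun _ e => e) = d - 1) :
    (HasRatFirstIntegral D d ∧ ∀ e, 1 ≤ e → e < d → ¬ HasRatFirstIntegral D e) ↔
      (extactic D d mono = 0 ∧ (1 < d → extactic D (d - 1) mono' ≠ 0)) := by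
  refine and_congr ⟨fun h => h.extactic_eq_zero hinj hdeg,
    hasRatFirstIntegral_of_extactic_eq_zero hhom hd hinj hdeg⟩ ⟨fun h hd1 h0 => ?_,
    fun h e he hed hI => ?_⟩
  · exact h (d - 1) (by omega) (by omega)
      (hasRatFirstIntegral_of_extactic_eq_zero hhom (by omega) hinj' hdeg' h0)
  · exact h (by omega) ((hI.mono (by omega)).extactic_eq_zero hinj' hdeg')
end

section
/- Let X = a·∂/∂x + b·∂/∂y + c·∂/∂z be a derivation on ℂ[x,y,z] with a, b, c homogeneous polynomials of the same degree m ≥ 1, and let n ≥ 1. Then the n-th extactic polynomial E_n(X) is either identically zero or a homogeneous polynomial of degree n·N(n) + (m−1)·N(n)(N(n)−1)/2 = (m(n⁴+6n³+11n²+6n) − n⁴ − 2n³ + n² + 2n)/8, where N(n) = (n+1)(n+2)/2. -/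
open MvPolynomial

namespace MvPolynomial

/-- A derivation with homogeneous coefficients of degree `k + 1` raises degrees by `k`. -/
theorem IsHomogeneous.derivation {σ R : Type*} [Fintype σ] [CommRing R]
    (D : Derivation R (MvPolynomial σ R) (MvPolynomial σ R)) {k : ℕ}
    (hD : ∀ i, (D (X i)).IsHomogeneous (k + 1)) {d : ℕ} {p : MvPolynomial σ R}
    (hp : p.IsHomogeneous d) : (D p).IsHomogeneous (d + k) := by
  have coe_sum (f : σ → Derivation R (MvPolynomial σ R) (MvPolynomial σ R)) :
      ⇑(∑ i, f i) = ∑ i, ⇑(f i) := map_sum Derivation.coeFnAddMonoidHom f Finset.univ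
  have hDp : D p = ∑ i, pderiv i p * D (X i) := by
    have h : D = ∑ i, D (X i) • pderiv i := by
      classical
      refine derivation_ext fun j => ?_
      simp [coe_sum, pderiv_X, Pi.single_apply]
    conv_lhs => rw [h]
    simp [coe_sum, mul_comm]
  rcases d with _ | d
  · rw [totalDegree_eq_zero_iff_eq_C.mp (Nat.le_zero.mp hp.totalDegree_le)]
    simpa using isHomogeneous_zero σ R (0 + k)
  · rw [hDp]
    refine IsHomogeneous.sum _ _ _ fun i _ => ?_
    have := (hp.pderiv (i := i)).mul (hD i)
    rwa [show d + 1 - 1 + (k + 1) = d + 1 + k by omega] at this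

theorem IsHomogeneous.iterate_derivation {σ R : Type*} [Fintype σ] [CommRing R]
    (D : Derivation R (MvPolynomial σ R) (MvPolynomial σ R)) {k : ℕ}
    (hD : ∀ i, (D (X i)).IsHomogeneous (k + 1)) {d : ℕ} {p : MvPolynomial σ R}
    (hp : p.IsHomogeneous d) (r : ℕ) : ((⇑D)^[r] p).IsHomogeneous (d + k * r) := by
  induction r with
  | zero => simpa using hp
  | succ r ih =>
    rw [Function.iterate_succ_apply', Nat.mul_succ, ← add_assoc]
    exact ih.derivation D hD

/-- If the entries of each row `i` are homogeneous of degree `w i`, then the determinant is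
homogeneous of degree `∑ i, w i`. -/
theorem IsHomogeneous.det {σ R ι : Type*} [CommRing R] [Fintype ι] [DecidableEq ι]
    (M : Matrix ι ι (MvPolynomial σ R)) (w : ι → ℕ) (hM : ∀ i j, (M i j).IsHomogeneous (w i)) :
    M.det.IsHomogeneous (∑ i, w i) := by
  rw [Matrix.det_apply']
  refine IsHomogeneous.sum _ _ _ fun τ _ => ?_
  have hprod : (∏ i, M (τ i) i).IsHomogeneous (∑ i, w i) := by
    rw [← Equiv.sum_comp τ w]
    exact IsHomogeneous.prod _ _ _ fun i _ => hM (τ i) i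
  rcases Int.units_eq_one_or (Equiv.Perm.sign τ) with h | h
  · simpa [h] using hprod
  · simpa [h] using hprod.neg

end MvPolynomial

theorem extactic_degree_formula (k n : ℕ) :
    n * ((n + 1) * (n + 2) / 2) +
        k * (((n + 1) * (n + 2) / 2) * ((n + 1) * (n + 2) / 2 - 1) / 2) =
      ((k + 1) * (n ^ 4 + 6 * n ^ 3 + 11 * n ^ 2 + 6 * n) + n ^ 2 + 2 * n - n ^ 4
        - 2 * n ^ 3) / 8 := by
  have hN : 2 * ((n + 1) * (n + 2) / 2) = (n + 1) * (n + 2) :=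
    Nat.mul_div_cancel' (Nat.even_mul_succ_self (n + 1)).two_dvd
  generalize (n + 1) * (n + 2) / 2 = N at hN ⊢
  obtain ⟨t, rfl⟩ : ∃ t, N = t + 1 := ⟨N - 1, by have : 0 < (n + 1) * (n + 2) := by positivity
                                                 omega⟩
  have hT : 2 * ((t + 1) * t / 2) = (t + 1) * t :=
    Nat.mul_div_cancel' (by simpa [mul_comm] using (Nat.even_mul_succ_self t).two_dvd)
  rw [Nat.add_sub_cancel]
  generalize (t + 1) * t / 2 = T at hT ⊢
  have hA : n ^ 4 + 6 * n ^ 3 + 11 * n ^ 2 + 6 * n = 8 * T := by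
    zify at *
    linear_combination (-4 : ℤ) * hT - (2 * (t : ℤ) + n ^ 2 + 3 * n + 2) * hN
  have hB : 8 * (n * (t + 1)) = 4 * n ^ 3 + 12 * n ^ 2 + 8 * n := by
    linear_combination 4 * n * hN
  have hk : (k + 1) * (8 * T) = 8 * (k * T) + 8 * T := by ring
  rw [hA, hk]
  omega

/-- For a derivation `D = a·∂x + b·∂y + c·∂z` with `a,b,c` homogeneous of the same degree
`m ≥ 1`, the `n`-th extactic polynomial is either identically zero or homogeneous of degree
`n·N(n) + (m−1)·N(n)(N(n)−1)/2 = (m(n⁴+6n³+11n²+6n) − n⁴ − 2n³ + n² + 2n)/8`,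
where `N(n) = (n+1)(n+2)/2`. -/
theorem extactic_stmt_5
    (D : Derivation ℂ (MvPolynomial (Fin 3) ℂ) (MvPolynomial (Fin 3) ℂ))
    (m : ℕ) (hm : 1 ≤ m)
    (hhom : ∀ i : Fin 3, (D (X i)).IsHomogeneous m)
    (n : ℕ) (hn : 1 ≤ n)
    (mono : Fin ((n + 1) * (n + 2) / 2) → (Fin 3 →₀ ℕ))
    (hinj : Function.Injective mono)
    (hdeg : ∀ j, ((mono j).sum fun _ e => e) = n) :
    (extactic D n mono = 0 ∨
      (extactic D n mono).IsHomogeneous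
        (n * ((n + 1) * (n + 2) / 2) +
          (m - 1) * (((n + 1) * (n + 2) / 2) * ((n + 1) * (n + 2) / 2 - 1) / 2))) ∧
    n * ((n + 1) * (n + 2) / 2) +
        (m - 1) * (((n + 1) * (n + 2) / 2) * ((n + 1) * (n + 2) / 2 - 1) / 2) =
      (m * (n ^ 4 + 6 * n ^ 3 + 11 * n ^ 2 + 6 * n) + n ^ 2 + 2 * n - n ^ 4 - 2 * n ^ 3) / 8 := by
  obtain ⟨k, rfl⟩ := Nat.exists_eq_add_of_le' hm
  rw [Nat.add_sub_cancel]
  refine ⟨Or.inr ?_, extactic_degree_formula k n⟩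
  have hdet := IsHomogeneous.det
    (Matrix.of fun i j : Fin ((n + 1) * (n + 2) / 2) =>
      (⇑D)^[(i : ℕ)] (monomial (mono j) (1 : ℂ)))
    (fun i => n + k * (i : ℕ))
    fun i j => (isHomogeneous_monomial 1 (hdeg j)).iterate_derivation D hhom i
  have hsum (N : ℕ) : ∑ i : Fin N, (n + k * (i : ℕ)) = n * N + k * (N * (N - 1) / 2) := by
    rw [Finset.sum_add_distrib, ← Finset.mul_sum, Fin.sum_univ_eq_sum_range (fun i => i),
      Finset.sum_range_id]
    simp [mul_comm]
  rwa [hsum] at hdet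
end

section
/- For an integer d ≥ 2, let X_d = (x^{d−1} − z^{d−1})·x·∂/∂x + (y^{d−1} − z^{d−1})·y·∂/∂y, a derivation on ℂ[x,y,z]. Then the set of invariant lines of X_d, i.e., the set of equivalence classes up to nonzero scalar of nonzero linear forms ℓ ∈ ℂ[x,y,z] satisfying X_d(ℓ) = L·ℓ for some polynomial L, has exactly 3d elements, namely the classes of the 3d pairwise non-proportional linear factors of F_d = x·y·z·(x^{d−1} − z^{d−1})·(y^{d−1} − z^{d−1})·(x^{d−1} − y^{d−1}). -/
open MvPolynomial

/-- The polynomial `F_d = x·y·z·(x^{d−1} − z^{d−1})·(y^{d−1} − z^{d−1})·(x^{d−1} − y^{d−1})`. -/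
noncomputable def Fd (d : ℕ) : MvPolynomial (Fin 3) ℂ :=
  X 0 * X 1 * X 2 * ((X 0) ^ (d - 1) - (X 2) ^ (d - 1)) *
    ((X 1) ^ (d - 1) - (X 2) ^ (d - 1)) * ((X 0) ^ (d - 1) - (X 1) ^ (d - 1))

/-- The linear forms `X i` and `X i - ζ X (i + 1)`, where `ζ` is an `n`-th root of unity and the
indices are read cyclically. -/
noncomputable def cyclicLine {n : ℕ} (p : Fin 3 × Option (rootsOfUnity n ℂ)) :
    MvPolynomial (Fin 3) ℂ :=
  match p.2 with
  | none => X p.1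
  | some ζ => X p.1 - C ((ζ : ℂˣ) : ℂ) * X (p.1 + 1)

lemma rootsOfUnity_coe_pow {n : ℕ} (ζ : rootsOfUnity n ℂ) : ((ζ : ℂˣ) : ℂ) ^ n = 1 := by
  have h := ζ.2
  rw [mem_rootsOfUnity] at h
  rw [← Units.val_pow_eq_pow_val, h, Units.val_one]

lemma cyclicLine_isHomogeneous {n : ℕ} (p : Fin 3 × Option (rootsOfUnity n ℂ)) :
    (cyclicLine p).IsHomogeneous 1 := by
  obtain ⟨i, _ | ζ⟩ := p
  · exact isHomogeneous_X ℂ i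
  · exact (isHomogeneous_X ℂ i).sub (isHomogeneous_C_mul_X _ _)

lemma cyclicLine_ne_smul {n : ℕ} {p q : Fin 3 × Option (rootsOfUnity n ℂ)} (hpq : p ≠ q) (c : ℂ) :
    cyclicLine p ≠ c • cyclicLine q := by
  intro h
  have e (k : Fin 3) := congrArg (eval (Pi.single k (1 : ℂ))) h
  have e0 := e 0
  have e1 := e 1
  have e2 := e 2
  obtain ⟨i, _ | ζ⟩ := p <;> obtain ⟨j, _ | ξ⟩ := q <;> fin_cases i <;> fin_cases j <;>
    simp [cyclicLine, smul_eval] at e0 e1 e2 hpq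
  all_goals first | grind | exact hpq (Subtype.ext (Units.ext (by grind)))

lemma cyclicLine_ne_zero {n : ℕ} (p : Fin 3 × Option (rootsOfUnity n ℂ)) : cyclicLine p ≠ 0 := by
  obtain ⟨i, o⟩ := p
  have hne : (i, o) ≠ (i + 1, o) := by simp
  simpa using cyclicLine_ne_smul hne 0

lemma X_sub_C_mul_X_dvd {n : ℕ} {ζ : ℂ} (hζ : ζ ^ n = 1) (i j : Fin 3) :
    (X i - C ζ * X j : MvPolynomial (Fin 3) ℂ) ∣ X i ^ n - X j ^ n := by
  have h := sub_dvd_pow_sub_pow (X i : MvPolynomial (Fin 3) ℂ) (C ζ * X j) n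
  rwa [mul_pow, ← C_pow, hζ, C_1, one_mul] at h

lemma cyclicLine_dvd_Fd {d : ℕ} (p : Fin 3 × Option (rootsOfUnity (d - 1) ℂ)) :
    cyclicLine p ∣ Fd d := by
  obtain ⟨i, _ | ζ⟩ := p
  · refine Dvd.dvd.mul_right (Dvd.dvd.mul_right (Dvd.dvd.mul_right ?_ _) _) _
    fin_cases i
    · exact (Dvd.intro _ rfl).mul_right _
    · exact (Dvd.intro_left _ rfl).mul_right _
    · exact Dvd.intro_left _ rfl
  · refine (X_sub_C_mul_X_dvd (rootsOfUnity_coe_pow ζ) i (i + 1)).trans ?_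
    have h20 : (X 2 ^ (d - 1) - X 0 ^ (d - 1) : MvPolynomial (Fin 3) ℂ) ∣ Fd d := by
      rw [← neg_sub, neg_dvd]
      exact ((Dvd.intro_left _ rfl).mul_right _).mul_right _
    fin_cases i
    · exact Dvd.intro_left _ rfl
    · exact (Dvd.intro_left _ rfl).mul_right _
    · exact h20

lemma apply_X_eq_mul_X {n : ℕ}
    {D : Derivation ℂ (MvPolynomial (Fin 3) ℂ) (MvPolynomial (Fin 3) ℂ)}
    (hDx : D (X 0) = (X 0 ^ n - X 2 ^ n) * X 0) (hDy : D (X 1) = (X 1 ^ n - X 2 ^ n) * X 1)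
    (hDz : D (X 2) = 0) (i : Fin 3) : D (X i) = (X i ^ n - X 2 ^ n) * X i := by
  fin_cases i
  · exact hDx
  · exact hDy
  · simpa using hDz

section Invariant

variable {n : ℕ} {D : Derivation ℂ (MvPolynomial (Fin 3) ℂ) (MvPolynomial (Fin 3) ℂ)}

lemma cyclicLine_invariant (hD : ∀ i, D (X i) = (X i ^ n - X 2 ^ n) * X i)
    (p : Fin 3 × Option (rootsOfUnity n ℂ)) : ∃ L, D (cyclicLine p) = L * cyclicLine p := by
  obtain ⟨i, _ | ζ⟩ := p
  · exact ⟨_, hD i⟩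
  · obtain ⟨q, hq⟩ := X_sub_C_mul_X_dvd (rootsOfUnity_coe_pow ζ) i (i + 1)
    refine ⟨q * X i + (X (i + 1) ^ n - X 2 ^ n), ?_⟩
    simp only [cyclicLine, ← smul_eq_C_mul, map_sub, Derivation.map_smul, hD] at hq ⊢
    simp only [smul_eq_C_mul] at hq ⊢
    linear_combination X i * hq

lemma sum_mul_pow_succ_eq_zero (hD : ∀ i, D (X i) = (X i ^ n - X 2 ^ n) * X i) {a : Fin 3 → ℂ}
    {L : MvPolynomial (Fin 3) ℂ} (hL : D (∑ i, C (a i) * X i) = L * ∑ i, C (a i) * X i)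
    {p : Fin 3 → ℂ} (hp : ∑ i, a i * p i = 0) : ∑ i, a i * p i ^ (n + 1) = 0 := by
  have h := congrArg (eval p) hL
  simp only [← smul_eq_C_mul, map_sum, Derivation.map_smul, hD, map_mul, map_sub, map_pow,
    smul_eval, eval_X, hp, mul_zero] at h
  simp only [Fin.sum_univ_three] at h hp ⊢
  linear_combination h + p 2 ^ n * hp

end Invariant

lemma MvPolynomial.IsHomogeneous.exists_eq_sum_C_mul_X {σ R : Type*} [Fintype σ] [CommSemiring R]
    {ℓ : MvPolynomial σ R} (h : ℓ.IsHomogeneous 1) : ∃ a : σ → R, ℓ = ∑ i, C (a i) * X i := by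
  rw [← mem_homogeneousSubmodule, homogeneousSubmodule_one_eq_span_X,
    Submodule.mem_span_range_iff_exists_fun] at h
  obtain ⟨a, rfl⟩ := h
  exact ⟨a, by simp only [smul_eq_C_mul]⟩

/-- If `∑ aᵢ pᵢ ^ (n + 1)` vanishes on the line `∑ aᵢ pᵢ = 0`, then `-aⱼ / aᵢ` is an `n`-th root of
unity for all nonzero coefficients `aᵢ`, `aⱼ` with `i ≠ j`. -/
lemma neg_div_pow_eq_one {n : ℕ} {a : Fin 3 → ℂ}
    (H : ∀ p : Fin 3 → ℂ, ∑ i, a i * p i = 0 → ∑ i, a i * p i ^ (n + 1) = 0)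
    {i j : Fin 3} (hij : i ≠ j) (hi : a i ≠ 0) (hj : a j ≠ 0) : (-a j / a i) ^ n = 1 := by
  have hsum (m : ℕ) (hm : m ≠ 0) :
      ∑ k, a k * (Pi.single i (-a j / a i) + Pi.single j 1 : Fin 3 → ℂ) k ^ m =
        a i * (-a j / a i) ^ m + a j := by
    rw [Fintype.sum_eq_add i j hij]
    · simp [hij, hij.symm]
    · rintro k ⟨hki, hkj⟩
      simp [hki, hkj, hm]
  have h := H (Pi.single i (-a j / a i) + Pi.single j 1) (by
    have := hsum 1 one_ne_zero
    simp only [pow_one] at this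
    rw [this]; field_simp; ring)
  rw [hsum _ n.succ_ne_zero, pow_succ] at h
  have h2 : a j * ((-a j / a i) ^ n - 1) = 0 := by
    have h3 : a i * (-a j / a i) = -a j := by field_simp
    linear_combination -h + (-a j / a i) ^ n * h3
  exact sub_eq_zero.1 ((mul_eq_zero.1 h2).resolve_left hj)

lemma exists_eq_zero_of_sum_mul_pow {n : ℕ} (hn : n ≠ 0) {a : Fin 3 → ℂ}
    (H : ∀ p : Fin 3 → ℂ, ∑ i, a i * p i = 0 → ∑ i, a i * p i ^ (n + 1) = 0) :
    ∃ i, a i = 0 := by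
  by_contra! ha
  have h0 := neg_div_pow_eq_one H (i := 0) (j := 2) (by decide) (ha 0) (ha 2)
  have h1 := neg_div_pow_eq_one H (i := 1) (j := 2) (by decide) (ha 1) (ha 2)
  have e0 : a 0 * (-a 2 / a 0) = -a 2 := by field_simp [ha 0]
  have e1 : a 1 * (-a 2 / a 1) = -a 2 := by field_simp [ha 1]
  have h := H ![2 * (-a 2 / a 0), -1 * (-a 2 / a 1), 1] (by
    simp only [Fin.sum_univ_three, Matrix.cons_val]
    linear_combination 2 * e0 - e1)
  simp only [Fin.sum_univ_three, Matrix.cons_val, mul_pow, pow_succ _ n, h0, h1] at h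
  have h2 : a 2 * (2 ^ n * 2 - (-1) ^ n - 1) = 0 := by
    linear_combination -h + 2 ^ n * 2 * e0 - (-1) ^ n * e1
  have h3 := (mul_eq_zero.1 h2).resolve_left (ha 2)
  have h4 : (2 : ℝ) ^ n * 2 - (-1) ^ n - 1 = 0 := by exact_mod_cast h3
  have h5 : (2 : ℝ) ≤ 2 ^ n := le_self_pow₀ one_le_two hn
  rcases neg_one_pow_eq_or ℝ n with h6 | h6 <;> rw [h6] at h4 <;> linarith

lemma exists_eq_smul_cyclicLine {n : ℕ} (hn : n ≠ 0) {a : Fin 3 → ℂ} (ha : a ≠ 0)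
    (H : ∀ p : Fin 3 → ℂ, ∑ i, a i * p i = 0 → ∑ i, a i * p i ^ (n + 1) = 0) :
    ∃ (p : Fin 3 × Option (rootsOfUnity n ℂ)) (c : ℂ),
      c ≠ 0 ∧ ∑ i, C (a i) * X i = c • cyclicLine p := by
  have : NeZero n := ⟨hn⟩
  obtain ⟨k, hk⟩ := exists_eq_zero_of_sum_mul_pow hn H
  have hsum : ∑ i, C (a i) * X i =
      (C (a (k + 1)) * X (k + 1) + C (a (k + 2)) * X (k + 2) : MvPolynomial (Fin 3) ℂ) := by
    rw [← Equiv.sum_comp (Equiv.addLeft k), Fin.sum_univ_three]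
    simp [hk]
  rw [hsum]
  by_cases h1 : a (k + 1) = 0
  · refine ⟨(k + 2, none), a (k + 2), fun h2 ↦ ha ?_, by simp [h1, cyclicLine, smul_eq_C_mul]⟩
    ext i
    fin_cases k <;> fin_cases i <;> first | exact hk | exact h1 | exact h2
  by_cases h2 : a (k + 2) = 0
  · exact ⟨(k + 1, none), a (k + 1), h1, by simp [h2, cyclicLine, smul_eq_C_mul]⟩
  have hζ := neg_div_pow_eq_one H (by simp) h1 h2
  refine ⟨(k + 1, some (rootsOfUnity.mkOfPowEq _ hζ)), a (k + 1), h1, ?_⟩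
  have hk2 : k + 1 + 1 = k + 2 := by rw [add_assoc]; rfl
  have hC : (C (a (k + 1)) * C (-a (k + 2) / a (k + 1)) : MvPolynomial (Fin 3) ℂ) =
      -C (a (k + 2)) := by
    rw [← C_mul, mul_div_cancel₀ _ h1, C_neg]
  simp only [cyclicLine, smul_eq_C_mul, rootsOfUnity.coe_mkOfPowEq, hk2]
  linear_combination X (k + 2) * hC

/-- For `d ≥ 2`, the derivation `X_d = (x^{d−1} − z^{d−1})·x·∂x + (y^{d−1} − z^{d−1})·y·∂y`
has exactly `3d` invariant lines, namely the classes (up to nonzero scalar) of the `3d`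
pairwise non-proportional linear factors of `F_d`. -/
theorem extactic_stmt_8 (d : ℕ) (hd : 2 ≤ d)
    (D : Derivation ℂ (MvPolynomial (Fin 3) ℂ) (MvPolynomial (Fin 3) ℂ))
    (hDx : D (X 0) = ((X 0) ^ (d - 1) - (X 2) ^ (d - 1)) * X 0)
    (hDy : D (X 1) = ((X 1) ^ (d - 1) - (X 2) ^ (d - 1)) * X 1)
    (hDz : D (X 2) = 0) :
    ∃ f : Fin (3 * d) → MvPolynomial (Fin 3) ℂ,
      (∀ i, f i ≠ 0 ∧ (f i).IsHomogeneous 1 ∧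
        (∃ L : MvPolynomial (Fin 3) ℂ, D (f i) = L * f i) ∧ f i ∣ Fd d) ∧
      (∀ i j, i ≠ j → ∀ c : ℂ, f i ≠ c • f j) ∧
      (∀ ℓ : MvPolynomial (Fin 3) ℂ, ℓ ≠ 0 → ℓ.IsHomogeneous 1 →
        (∃ L : MvPolynomial (Fin 3) ℂ, D ℓ = L * ℓ) →
        ∃ i, ∃ c : ℂ, c ≠ 0 ∧ ℓ = c • f i) := by
  have hn : d - 1 ≠ 0 := by omega
  have : NeZero (d - 1) := ⟨hn⟩
  have hD := apply_X_eq_mul_X hDx hDy hDz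
  have hcard : Nat.card (Fin 3 × Option (rootsOfUnity (d - 1) ℂ)) = 3 * d := by
    rw [Nat.card_prod, Finite.card_option, Complex.card_rootsOfUnity, Nat.card_fin]
    omega
  let e := (Finite.equivFinOfCardEq hcard).symm
  refine ⟨fun i ↦ cyclicLine (e i), fun i ↦ ⟨cyclicLine_ne_zero _, cyclicLine_isHomogeneous _,
    cyclicLine_invariant hD _, cyclicLine_dvd_Fd _⟩,
    fun i j hij c ↦ cyclicLine_ne_smul (e.injective.ne hij) c, ?_⟩
  rintro ℓ hℓ hhom ⟨L, hL⟩
  obtain ⟨a, rfl⟩ := hhom.exists_eq_sum_C_mul_X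
  have ha : a ≠ 0 := by
    rintro rfl
    simp at hℓ
  obtain ⟨p, c, hc, h⟩ := exists_eq_smul_cyclicLine hn ha
    fun p hp ↦ sum_mul_pow_succ_eq_zero hD hL hp
  exact ⟨e.symm p, c, hc, by simpa using h⟩
end

section
/- Let X = a·∂/∂x + b·∂/∂y + c·∂/∂z be a derivation on ℂ[x,y,z] with a, b, c homogeneous polynomials of the same degree m ≥ 1. (i) If ℓ = αx + βy is a nonzero linear form (with α, β ∈ ℂ) satisfying X(ℓ) = L·ℓ for some polynomial L, then ℓ divides x·b − y·a. (ii) Consequently, if x·b − y·a ≠ 0, then there are at most m + 1 pairwise non-proportional invariant linear forms lying in the ℂ-span of x and y (i.e., invariant lines through the point [0:0:1]). -/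
open MvPolynomial

/-- A nonzero linear form in two variables has a nonzero coefficient. -/
theorem coeff_ne_zero_of_linearForm_ne_zero {σ R : Type*} [CommSemiring R] {i j : σ} {α β : R}
    (hne : (C α * X i + C β * X j : MvPolynomial σ R) ≠ 0) : α ≠ 0 ∨ β ≠ 0 := by
  contrapose! hne
  simp [hne.1, hne.2]

/-- An invariant linear form `αx + βy` of a derivation `D` divides `x·D(y) − y·D(x)`. -/
theorem linearForm_dvd_of_invariant
    (D : Derivation ℂ (MvPolynomial (Fin 3) ℂ) (MvPolynomial (Fin 3) ℂ)) {α β : ℂ}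
    (hne : α ≠ 0 ∨ β ≠ 0) {L : MvPolynomial (Fin 3) ℂ}
    (hL : D (C α * X 0 + C β * X 1) = L * (C α * X 0 + C β * X 1)) :
    (C α * X 0 + C β * X 1) ∣ (X 0 * D (X 1) - X 1 * D (X 0)) := by
  have key : C α * D (X 0) + C β * D (X 1) = L * (C α * X 0 + C β * X 1) := by
    rw [← hL, ← smul_eq_C_mul, ← smul_eq_C_mul, ← smul_eq_C_mul, ← smul_eq_C_mul,
      map_add, D.map_smul, D.map_smul]
  have hunit : ∀ {t : ℂ}, t ≠ 0 → IsUnit (C t : MvPolynomial (Fin 3) ℂ) := fun ht =>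
    (IsUnit.mk0 _ ht).map C
  by_cases hα : α = 0
  · have hβ : β ≠ 0 := hne.resolve_left (not_not.2 hα)
    rw [← (hunit hβ).dvd_mul_left]
    exact ⟨X 0 * L - D (X 0), by linear_combination X 0 * key⟩
  · rw [← (hunit hα).dvd_mul_left]
    exact ⟨D (X 1) - X 1 * L, by linear_combination (-X 1) * key⟩

/-- Linear forms in two variables with nonzero determinant have no common factor. -/
theorem isRelPrime_linearForm {σ K : Type*} [Field K] {i j : σ} (hij : i ≠ j) {α β γ δ : K}
    (hdet : α * δ - β * γ ≠ 0) :
    IsRelPrime (C α * X i + C β * X j : MvPolynomial σ K) (C γ * X i + C δ * X j) := by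
  intro d h₁ h₂
  have hu : IsUnit (C (α * δ - β * γ) : MvPolynomial σ K) := (IsUnit.mk0 _ hdet).map C
  have hi : d ∣ X i := by
    rw [← hu.dvd_mul_left]
    convert dvd_sub (h₁.mul_left (C δ)) (h₂.mul_left (C β)) using 1
    simp only [map_sub, map_mul]
    ring
  have hj : d ∣ X j := by
    rw [← hu.dvd_mul_left]
    convert dvd_sub (h₂.mul_left (C α)) (h₁.mul_left (C γ)) using 1
    simp only [map_sub, map_mul]
    ring
  refine ((X_prime (R := K) (i := i)).irreducible.isRelPrime_iff_not_dvd.2 fun h => ?_) hi hj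
  exact hij (X_dvd_X.1 h)

/-- Nonzero linear forms in two variables with zero determinant are proportional. -/
theorem exists_linearForm_eq_smul {σ K : Type*} [Field K] {i j : σ} {α β γ δ : K}
    (hne : (C γ * X i + C δ * X j : MvPolynomial σ K) ≠ 0) (hdet : α * δ - β * γ = 0) :
    ∃ t : K, (C α * X i + C β * X j : MvPolynomial σ K) = t • (C γ * X i + C δ * X j) := by
  suffices h : ∃ t : K, α = t * γ ∧ β = t * δ by
    obtain ⟨t, rfl, rfl⟩ := h
    refine ⟨t, ?_⟩
    simp only [smul_eq_C_mul, map_mul]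
    ring
  by_cases hγ : γ = 0
  · have hδ : δ ≠ 0 :=
      (coeff_ne_zero_of_linearForm_ne_zero hne).resolve_left (not_not.2 hγ)
    refine ⟨β / δ, ?_, by field_simp⟩
    field_simp
    linear_combination hdet
  · refine ⟨α / γ, by field_simp, ?_⟩
    field_simp
    linear_combination -hdet

/-- Pairwise coprime forms of degree one dividing `p ≠ 0` number at most `p.totalDegree`. -/
theorem card_le_totalDegree_of_isRelPrime {σ K : Type*} [Field K] {k : ℕ}
    {f : Fin k → MvPolynomial σ K} {p : MvPolynomial σ K} (hp : p ≠ 0)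
    (hf : ∀ i, (f i).IsHomogeneous 1) (hne : ∀ i, f i ≠ 0) (hdvd : ∀ i, f i ∣ p)
    (hrel : Pairwise fun i j => IsRelPrime (f i) (f j)) : k ≤ p.totalDegree := by
  have hprod : (∏ i, f i).totalDegree = k := by
    have h := IsHomogeneous.prod Finset.univ f (fun _ => 1) fun i _ => hf i
    simpa using h.totalDegree (Finset.prod_ne_zero_iff.2 fun i _ => hne i)
  have h : ∏ i, f i ∣ p :=
    Finset.prod_dvd_of_isRelPrime (fun i _ j _ hij => hrel hij) fun i _ => hdvd i
  exact hprod ▸ totalDegree_le_of_dvd_of_isDomain h hp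

/-- For a derivation `D = a·∂x + b·∂y + c·∂z` with `a,b,c` homogeneous of the same degree
`m ≥ 1`: (i) every nonzero invariant linear form `αx + βy` divides `x·b − y·a`;
(ii) if `x·b − y·a ≠ 0`, there are at most `m + 1` pairwise non-proportional invariant
linear forms in the span of `x` and `y` (invariant lines through `[0:0:1]`). -/
theorem extactic_stmt_9
    (D : Derivation ℂ (MvPolynomial (Fin 3) ℂ) (MvPolynomial (Fin 3) ℂ))
    (m : ℕ) (hm : 1 ≤ m) (a b c : MvPolynomial (Fin 3) ℂ)
    (ha : a.IsHomogeneous m) (hb : b.IsHomogeneous m) (hc : c.IsHomogeneous m)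
    (hDx : D (X 0) = a) (hDy : D (X 1) = b) (hDz : D (X 2) = c) :
    (∀ α β : ℂ, C α * X 0 + C β * X 1 ≠ 0 →
      ∀ L : MvPolynomial (Fin 3) ℂ,
        D (C α * X 0 + C β * X 1) = L * (C α * X 0 + C β * X 1) →
        (C α * X 0 + C β * X 1) ∣ (X 0 * b - X 1 * a)) ∧
    (X 0 * b - X 1 * a ≠ 0 →
      ∀ (k : ℕ) (f : Fin k → MvPolynomial (Fin 3) ℂ),
        (∀ i, f i ≠ 0) →
        (∀ i, f i ∈ Submodule.span ℂ ({X 0, X 1} : Set (MvPolynomial (Fin 3) ℂ))) →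
        (∀ i, ∃ L : MvPolynomial (Fin 3) ℂ, D (f i) = L * f i) →
        (∀ i j, i ≠ j → ∀ t : ℂ, f i ≠ t • f j) →
        k ≤ m + 1) := by
  subst hDx hDy
  refine ⟨fun α β hne L hL => linearForm_dvd_of_invariant D
    (coeff_ne_zero_of_linearForm_ne_zero hne) hL, ?_⟩
  intro hp k f hne hspan hinv hprop
  have hform : ∀ i, ∃ α β : ℂ, f i = C α * X 0 + C β * X 1 := fun i => by
    obtain ⟨α, β, h⟩ := Submodule.mem_span_pair.1 (hspan i)
    exact ⟨α, β, by rw [← h, smul_eq_C_mul, smul_eq_C_mul]⟩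
  choose α β hf using hform
  have hdeg : (X 0 * D (X 1) - X 1 * D (X 0)).totalDegree ≤ m + 1 := by
    refine IsHomogeneous.totalDegree_le ?_
    rw [add_comm]
    exact ((isHomogeneous_X _ _).mul hb).sub ((isHomogeneous_X _ _).mul ha)
  refine (card_le_totalDegree_of_isRelPrime hp (fun i => ?_) hne (fun i => ?_) ?_).trans hdeg
  · rw [hf i]
    exact (isHomogeneous_C_mul_X _ _).add (isHomogeneous_C_mul_X _ _)
  · obtain ⟨L, hL⟩ := hinv i
    have hi := hne i
    rw [hf i] at hL hi ⊢
    exact linearForm_dvd_of_invariant D (coeff_ne_zero_of_linearForm_ne_zero hi) hL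
  · intro i j hij
    have hj := hne j
    rw [hf j] at hj
    simp only [hf i, hf j]
    refine isRelPrime_linearForm (by decide) fun hdet => ?_
    obtain ⟨t, ht⟩ := exists_linearForm_eq_smul (i := 0) (j := 1) hj hdet
    exact hprop i j hij t (by rw [hf i, hf j, ht])
end
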